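/- (Theorem 2, quantitative part: weak mixing implies exponentially fast ergodicity for class-C PCA.) Let d ≥ 1, β > 0 and K : ℤ^d → ℝ symmetric with finite range R > 0 and K ≥ 0, and let P be the infinite-volume class-C PCA dynamics on {−1,+1}^{ℤ^d}. Assume the weak mixing condition in finite-volume form: there exist C > 0 and M > 0 such that for every integer L ≥ 2, ∫ σ₀ dμ_{B_L}^{+} − ∫ σ₀ dμ_{B_L}^{−} ≤ C e^{−M L}. Then P admits a unique stationary probability measure ν on {−1,+1}^{ℤ^d}, and there exist λ > 0 and n₁ ∈ ℕ* such that for every n ≥ n₁ and every local function f: sup_{σ} | ∫ f d(δ_σ P^{(n)}) − ∫ f dν | ≤ 2 |||f||| e^{−λ n}. -/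

import Mathlib

open MeasureTheory ProbabilityTheory

namespace ClassC

/-- Sites of the lattice `ℤ^d`. -/
abbrev Site (d : ℕ) := Fin d → ℤ

/-- The spin space `{-1,+1} ⊂ ℝ`. -/
abbrev Spin : Type := ({-1, 1} : Finset ℝ)

/-- The spin `+1`. -/
def sPlus : Spin := ⟨1, by simp⟩
/-- The spin `-1`. -/
def sMinus : Spin := ⟨-1, by simp⟩

/-- Configuration space `{-1,+1}^{ℤ^d}`. -/
abbrev Config (d : ℕ) := Site d → Spin

variable {d : ℕ}

/-- The constant configuration `+1` (respectively `-1`). -/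
def cPlus (d : ℕ) : Config d := fun _ => sPlus
def cMinus (d : ℕ) : Config d := fun _ => sMinus

/-- `K` is symmetric with finite range `R`: `K(k) = K(-k)` and `K(k) = 0` as soon as
`Σᵢ |kᵢ| > R`. -/
def SymmFiniteRange (K : Site d → ℝ) (R : ℕ) : Prop :=
  (∀ k, K (-k) = K k) ∧ ∀ k : Site d, (R : ℤ) < ∑ i, |k i| → K k = 0

/-- The ball `B_L = {k : Σᵢ |kᵢ| ≤ L}` for the ℓ¹ norm on `ℤ^d`. -/
noncomputable def ball (d L : ℕ) : Finset (Site d) :=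
  (Finset.Icc (fun _ => -(L : ℤ)) (fun _ => (L : ℤ))).filter fun k => ∑ i, |k i| ≤ (L : ℤ)

lemma zero_mem_ball (d L : ℕ) : (0 : Site d) ∈ ball d L := by
  simp [ball, Finset.mem_filter, Finset.mem_Icc, Pi.le_def]

/-- `patch Λ σ τ` is the configuration `σ_Λ τ_{Λᶜ}`. -/
def patch (Λ : Finset (Site d)) (σ : ↥Λ → Spin) (τ : Config d) : Config d :=
  fun j => if h : j ∈ Λ then σ ⟨j, h⟩ else τ j

/-- The local mean field `β Σ_{k'} K(k'-k) η_{k'}` at site `k`. -/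
noncomputable def field (β : ℝ) (K : Site d → ℝ) (k : Site d) (η : Config d) : ℝ :=
  β * ∑ᶠ k' : Site d, K (k' - k) * (η k' : ℝ)

/-- The class-C updating rule `p_k(s|η) = ½ (1 + s tanh(β Σ_{k'} K(k'-k) η_{k'}))`. -/
noncomputable def upd (β : ℝ) (K : Site d → ℝ) (k : Site d) (η : Config d) (s : Spin) : ℝ :=
  (1 + (s : ℝ) * Real.tanh (field β K k η)) / 2

/-- Transition probabilities of the finite volume class-C dynamics `P_Λ^τ` on
`{-1,+1}^Λ`: `P_Λ^τ(σ|η) = Π_{k∈Λ} p_k(σ_k | η_Λ τ_{Λᶜ})`. -/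
noncomputable def fvKer (β : ℝ) (K : Site d → ℝ) (Λ : Finset (Site d)) (τ : Config d)
    (η σ : ↥Λ → Spin) : ℝ :=
  ∏ k : ↥Λ, upd β K (k : Site d) (patch Λ η τ) (σ k)

/-- The unnormalised weight of the finite volume reversible measure `ν_Λ^τ`:
`Π_{k∈Λ} cosh(β Σ_j K(k-j) σ̃_j) exp(β σ_k Σ_{j∈Λᶜ} K(k-j) τ_j)` with `σ̃ = σ_Λ τ_{Λᶜ}`. -/
noncomputable def nuWeight (β : ℝ) (K : Site d → ℝ) (Λ : Finset (Site d)) (τ : Config d)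
    (σ : ↥Λ → Spin) : ℝ :=
  ∏ k : ↥Λ,
    Real.cosh (β * ∑ᶠ j : Site d, K ((k : Site d) - j) * ((patch Λ σ τ) j : ℝ)) *
      Real.exp (β * (σ k : ℝ) * ∑ᶠ j ∈ {j : Site d | j ∉ Λ}, K ((k : Site d) - j) * (τ j : ℝ))

/-- The finite volume measure `ν_Λ^τ` (normalised weight). -/
noncomputable def nuFV (β : ℝ) (K : Site d → ℝ) (Λ : Finset (Site d)) (τ : Config d)
    (σ : ↥Λ → Spin) : ℝ :=
  nuWeight β K Λ τ σ / ∑ σ', nuWeight β K Λ τ σ'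

/-- The finite volume Hamiltonian `Σ_{A ∩ Λ ≠ ∅} φ_A(σ_Λ τ_{Λᶜ})` for the potential `φ`
canonically associated to the dynamics: `φ_{U_k} = - log cosh(β Σ_j K(k-j) σ_j)` on
`U_k = {j : K(k-j) ≠ 0}` and `φ_A = 0` otherwise; the sum over `A` meeting `Λ` is the
sum over those `k` with `U_k ∩ Λ ≠ ∅`. -/
noncomputable def ham (β : ℝ) (K : Site d → ℝ) (Λ : Finset (Site d)) (τ : Config d)
    (σ : ↥Λ → Spin) : ℝ :=
  ∑ᶠ (k : Site d) (_ : ∃ j ∈ Λ, K (k - j) ≠ 0),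
    -Real.log (Real.cosh (β * ∑ᶠ j : Site d, K (k - j) * ((patch Λ σ τ) j : ℝ)))

/-- The finite volume Gibbs measure `μ_Λ^τ = exp(-H_Λ^τ)/Z_Λ^τ`. -/
noncomputable def gibbsFV (β : ℝ) (K : Site d → ℝ) (Λ : Finset (Site d)) (τ : Config d)
    (σ : ↥Λ → Spin) : ℝ :=
  Real.exp (-ham β K Λ τ σ) / ∑ σ', Real.exp (-ham β K Λ τ σ')

/-- Mean value of the spin at the origin under a finite volume (probability) weight. -/
noncomputable def atZero {Λ : Finset (Site d)} (h : (0 : Site d) ∈ Λ)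
    (ν : (↥Λ → Spin) → ℝ) : ℝ :=
  ∑ σ, ν σ * ((σ ⟨0, h⟩ : ℝ))

/-- The inner boundary `∂ᵢΔ = {k ∈ Δ : U_k ∩ Δᶜ ≠ ∅}`, `U_k = {j : K(k-j) ≠ 0}`. -/
def ibdry (K : Site d → ℝ) (Δ : Finset (Site d)) : Set (Site d) :=
  {k | k ∈ Δ ∧ ∃ j ∉ Δ, K (k - j) ≠ 0}


/-- The cylinder set of configurations agreeing with `ζ` on `F`. -/
def cylinder (F : Finset (Site d)) (ζ : Config d) : Set (Config d) :=
  {σ | ∀ k ∈ F, σ k = ζ k}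

/-- The infinite-volume class-C PCA kernel `P(dσ|η) = ⊗_k p_k(dσ_k|η)`, characterized
through its (defining) values on cylinder sets. -/
def IsClassCKernel (β : ℝ) (K : Site d → ℝ) (P : Kernel (Config d) (Config d)) : Prop :=
  ∀ (η : Config d) (F : Finset (Site d)) (ζ : Config d),
    P η (cylinder F ζ) = ∏ k ∈ F, ENNReal.ofReal (upd β K k η (ζ k))

/-- `iter P n σ` is the law `δ_σ P^{(n)}` at time `n` of the Markov chain with
transition kernel `P` started from `σ`. -/
noncomputable def iter (P : Kernel (Config d) (Config d)) :
    ℕ → Config d → Measure (Config d)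
  | 0, σ => Measure.dirac σ
  | n + 1, σ => (iter P n σ).bind fun η => P η

/-- `f` is a local function: it depends on finitely many coordinates. -/
def IsLocalFn (f : Config d → ℝ) : Prop :=
  ∃ Λf : Finset (Site d), ∀ σ η : Config d, (∀ k ∈ Λf, σ k = η k) → f σ = f η

/-- `Var_k(f)`. -/
noncomputable def varAt (k : Site d) (f : Config d → ℝ) : ℝ :=
  sSup {x : ℝ | ∃ σ η : Config d, (∀ j, j ≠ k → σ j = η j) ∧ x = |f σ - f η|}

/-- The seminorm `|||f||| = Σ_k Var_k(f)`. -/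
noncomputable def norm3 (f : Config d → ℝ) : ℝ := ∑ᶠ k : Site d, varAt k f

end ClassC

namespace ClassC
variable {d : ℕ}

lemma spin_cases (s : Spin) : s = sPlus ∨ s = sMinus := by
  obtain ⟨x, hx⟩ := s
  simp only [Finset.mem_insert, Finset.mem_singleton] at hx
  rcases hx with rfl | rfl
  · right; rfl
  · left; rfl

@[simp] lemma coe_sPlus : ((sPlus : Spin) : ℝ) = 1 := rfl
@[simp] lemma coe_sMinus : ((sMinus : Spin) : ℝ) = -1 := rfl

lemma sMinus_ne_sPlus : sMinus ≠ sPlus := by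
  intro h
  have := congrArg (fun s : Spin => (s : ℝ)) h
  norm_num at this

lemma sMinus_le (s : Spin) : sMinus ≤ s := by
  rcases spin_cases s with rfl | rfl
  · rw [← Subtype.coe_le_coe]; norm_num
  · exact le_rfl

lemma le_sPlus (s : Spin) : s ≤ sPlus := by
  rcases spin_cases s with rfl | rfl
  · exact le_rfl
  · exact sMinus_le _

lemma cMinus_le (σ : Config d) : cMinus d ≤ σ := fun _ => sMinus_le _
lemma le_cPlus (σ : Config d) : σ ≤ cPlus d := fun _ => le_sPlus _

lemma sum_spin (f : Spin → ℝ) : ∑ s, f s = f sPlus + f sMinus := by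
  have : (Finset.univ : Finset Spin) = {sPlus, sMinus} := by
    ext s
    simp only [Finset.mem_univ, Finset.mem_insert, Finset.mem_singleton, true_iff]
    exact spin_cases s
  rw [this, Finset.sum_pair sMinus_ne_sPlus.symm]

/-- finite-range sum -/
noncomputable def hsum (K : Site d → ℝ) (R : ℕ) (k : Site d) (x : Site d → ℝ) : ℝ :=
  ∑ j ∈ ball d R, K j * x (k + j)

lemma mem_ball {L : ℕ} {k : Site d} : k ∈ ball d L ↔ ∑ i, |k i| ≤ (L : ℤ) := by
  unfold ball
  simp only [Finset.mem_filter, Finset.mem_Icc, and_iff_right_iff_imp]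
  intro h
  have h1 : ∀ i, |k i| ≤ (L : ℤ) := fun i =>
    (Finset.single_le_sum (f := fun i => |k i|) (fun i _ => abs_nonneg _) (Finset.mem_univ i)).trans h
  exact ⟨fun i => (abs_le.1 (h1 i)).1, fun i => (abs_le.1 (h1 i)).2⟩

lemma ball_add {L L' : ℕ} {k j : Site d} (hk : k ∈ ball d L) (hj : j ∈ ball d L') :
    k + j ∈ ball d (L + L') := by
  rw [mem_ball] at *
  push_cast
  calc ∑ i, |(k + j) i| ≤ ∑ i, (|k i| + |j i|) := Finset.sum_le_sum fun i _ => abs_add_le _ _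
    _ ≤ _ := by rw [Finset.sum_add_distrib]; exact add_le_add hk hj

lemma ball_neg {L : ℕ} {k : Site d} (hk : k ∈ ball d L) : -k ∈ ball d L := by
  rw [mem_ball] at *; simpa using hk

lemma K_zero {K : Site d → ℝ} {R : ℕ} (hK : SymmFiniteRange K R) {k : Site d}
    (h : k ∉ ball d R) : K k = 0 := by
  apply hK.2; rw [mem_ball] at h; exact not_le.1 h

lemma finsum_eq_hsum {K : Site d → ℝ} {R : ℕ} (hK : SymmFiniteRange K R) (k : Site d)
    (x : Site d → ℝ) : ∑ᶠ k' : Site d, K (k' - k) * x k' = hsum K R k x := by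
  have e : ∑ᶠ k' : Site d, K (k' - k) * x k' = ∑ᶠ j : Site d, K j * x (k + j) := by
    rw [← finsum_comp_equiv (Equiv.addLeft k)]
    simp
  rw [e, hsum]
  apply finsum_eq_sum_of_support_subset
  intro j hj
  by_contra h
  apply hj
  simp [K_zero hK h]

lemma finsum_eq_hsum' {K : Site d → ℝ} {R : ℕ} (hK : SymmFiniteRange K R) (k : Site d)
    (x : Site d → ℝ) : ∑ᶠ k' : Site d, K (k - k') * x k' = hsum K R k x := by
  rw [← finsum_eq_hsum hK]
  congr 1; ext k'
  rw [← hK.1, neg_sub]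

lemma hsum_add (K : Site d → ℝ) (R : ℕ) (k : Site d) (x y : Site d → ℝ) :
    hsum K R k (x + y) = hsum K R k x + hsum K R k y := by
  simp [hsum, mul_add, Finset.sum_add_distrib]

lemma hsum_mono {K : Site d → ℝ} (hKpos : ∀ k, 0 ≤ K k) (R : ℕ) (k : Site d)
    {x y : Site d → ℝ} (h : ∀ j, x j ≤ y j) :
    hsum K R k x ≤ hsum K R k y :=
  Finset.sum_le_sum fun j _ => mul_le_mul_of_nonneg_left (h _) (hKpos _)

lemma hsum_supp {K : Site d → ℝ} {R : ℕ} (hK : SymmFiniteRange K R) (k : Site d)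
    (Λ : Finset (Site d)) (x : Site d → ℝ) (hx : ∀ j, j ∉ Λ → x j = 0) :
    hsum K R k x = ∑ l : ↥Λ, K (l - k) * x l := by
  rw [← finsum_eq_hsum hK, Finset.sum_coe_sort Λ (fun l => K (l - k) * x l)]
  apply finsum_eq_sum_of_support_subset
  intro j hj
  by_contra h
  apply hj
  simp [hx j (by simpa using h)]

/-- local field -/
noncomputable def fld (β : ℝ) (K : Site d → ℝ) (R : ℕ) (k : Site d) (η : Config d) : ℝ :=
  β * hsum K R k (fun j => (η j : ℝ))

lemma field_eq {K : Site d → ℝ} {R : ℕ} (hK : SymmFiniteRange K R) (β : ℝ) (k : Site d)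
    (η : Config d) : field β K k η = fld β K R k η := by
  rw [field, fld, finsum_eq_hsum hK]

lemma fld_mono {β : ℝ} (hβ : 0 < β) {K : Site d → ℝ} (hKpos : ∀ k, 0 ≤ K k) (R : ℕ) (k : Site d)
    {η ξ : Config d} (h : η ≤ ξ) : fld β K R k η ≤ fld β K R k ξ :=
  mul_le_mul_of_nonneg_left (hsum_mono hKpos R k fun _ => h _) hβ.le

lemma fld_congr (β : ℝ) (K : Site d → ℝ) (R : ℕ) (k : Site d)
    {η ξ : Config d} (h : ∀ j ∈ ball d R, η (k + j) = ξ (k + j)) : fld β K R k η = fld β K R k ξ := by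
  unfold fld hsum
  congr 1
  exact Finset.sum_congr rfl fun j hj => by simp only [h j hj]

lemma upd_eq {K : Site d → ℝ} {R : ℕ} (hK : SymmFiniteRange K R) (β : ℝ) (k : Site d)
    (η : Config d) (s : Spin) :
    upd β K k η s = Real.exp (s * fld β K R k η) / (2 * Real.cosh (fld β K R k η)) := by
  rw [upd, field_eq hK, Real.tanh_eq_sinh_div_cosh]
  have hc := Real.cosh_pos (fld β K R k η)
  field_simp
  rcases spin_cases s with rfl | rfl
  · simp only [coe_sPlus, one_mul]; rw [Real.cosh_add_sinh]
  · simp only [coe_sMinus, neg_mul, one_mul]; rw [← sub_eq_add_neg, Real.cosh_sub_sinh]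

lemma upd_pos {K : Site d → ℝ} {R : ℕ} (hK : SymmFiniteRange K R) (β : ℝ) (k : Site d)
    (η : Config d) (s : Spin) : 0 < upd β K k η s := by
  rw [upd_eq hK]
  have hc := Real.cosh_pos (fld β K R k η)
  positivity

lemma upd_sum (K : Site d → ℝ) (β : ℝ) (k : Site d)
    (η : Config d) : upd β K k η sPlus + upd β K k η sMinus = 1 := by
  simp [upd]; ring

lemma tanh_mono' {x y : ℝ} (h : x ≤ y) : Real.tanh x ≤ Real.tanh y := by
  rw [Real.tanh_eq_sinh_div_cosh, Real.tanh_eq_sinh_div_cosh,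
    div_le_div_iff₀ (Real.cosh_pos _) (Real.cosh_pos _)]
  have h2 := Real.sinh_nonneg_iff.2 (sub_nonneg.2 h)
  rw [Real.sinh_sub] at h2
  linarith

lemma upd_mono {K : Site d → ℝ} {R : ℕ} (hK : SymmFiniteRange K R) {β : ℝ} (hβ : 0 < β)
    (hKpos : ∀ k, 0 ≤ K k) (k : Site d)
    {η ξ : Config d} (h : η ≤ ξ) : upd β K k η sPlus ≤ upd β K k ξ sPlus := by
  simp only [upd, field_eq hK, coe_sPlus, one_mul]
  have := tanh_mono' (fld_mono hβ hKpos R k h)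
  linarith

lemma upd_congr {K : Site d → ℝ} {R : ℕ} (hK : SymmFiniteRange K R) (β : ℝ) (k : Site d)
    {η ξ : Config d} (h : ∀ j ∈ ball d R, η (k + j) = ξ (k + j)) (s : Spin) :
    upd β K k η s = upd β K k ξ s := by
  rw [upd, upd, field_eq hK, field_eq hK, fld_congr β K R k h]

/-- Holley for product measures -/
lemma prod_mono {ι : Type*} [Fintype ι] [DecidableEq ι] (w w' : ι → Spin → ℝ) (hw : ∀ k s, 0 ≤ w k s)
    (hw' : ∀ k s, 0 ≤ w' k s) (h1 : ∀ k, w k sPlus + w k sMinus = 1)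
    (h1' : ∀ k, w' k sPlus + w' k sMinus = 1) (hle : ∀ k, w k sPlus ≤ w' k sPlus)
    (u : (ι → Spin) → ℝ) (hu : Monotone u) :
    ∑ ζ : ι → Spin, (∏ k, w k (ζ k)) * u ζ ≤ ∑ ζ : ι → Spin, (∏ k, w' k (ζ k)) * u ζ := by
  have tot : ∀ v : ι → Spin → ℝ, (∀ k, v k sPlus + v k sMinus = 1) →
      ∑ ζ : ι → Spin, (∏ k, v k (ζ k)) = 1 := by
    intro v hv
    rw [← Fintype.prod_sum]
    exact Finset.prod_eq_one fun k _ => by rw [sum_spin, hv]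
  have key := holley (μ := fun ζ => u ζ - u (fun _ => sMinus))
    (f := fun ζ : ι → Spin => ∏ k, w k (ζ k)) (g := fun ζ => ∏ k, w' k (ζ k))
    (fun ζ => sub_nonneg.2 (hu fun _ => sMinus_le _))
    (fun ζ => Finset.prod_nonneg fun k _ => hw _ _)
    (fun ζ => Finset.prod_nonneg fun k _ => hw' _ _)
    (fun a b hab => sub_le_sub_right (hu hab) _)
    (by rw [tot w h1, tot w' h1'])
    (by
      intro a b
      simp only [← Finset.prod_mul_distrib]
      refine Finset.prod_le_prod (fun k _ => mul_nonneg (hw _ _) (hw' _ _)) fun k _ => ?_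
      simp only [Pi.inf_apply, Pi.sup_apply]
      rcases le_total (a k) (b k) with hh | hh
      · rw [inf_eq_left.2 hh, sup_eq_right.2 hh]
      · rw [inf_eq_right.2 hh, sup_eq_left.2 hh]
        rcases spin_cases (a k) with ha | ha <;> rcases spin_cases (b k) with hb | hb
        · rw [ha, hb]
        · rw [ha, hb]
          have := h1 k; have := h1' k; have := hle k; have := hw k sPlus; have := hw' k sPlus
          have e1 : w k sMinus = 1 - w k sPlus := by linarith
          have e2 : w' k sMinus = 1 - w' k sPlus := by linarith
          rw [e1, e2]; nlinarith
        · rw [ha, hb] at hh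
          exact absurd (le_antisymm (sMinus_le _) hh) sMinus_ne_sPlus
        · rw [ha, hb])
  simp only [sub_mul, Finset.sum_sub_distrib, ← Finset.mul_sum, tot w h1, tot w' h1'] at key
  simp only [mul_comm (u _)] at key
  linarith

end ClassC

namespace ClassC
variable {d : ℕ}

/-- dependence on finitely many sites -/
def DepOn (F : Finset (Site d)) (f : Config d → ℝ) : Prop :=
  ∀ σ η : Config d, (∀ k ∈ F, σ k = η k) → f σ = f η

lemma patch_mem (Λ : Finset (Site d)) (σ : ↥Λ → Spin) (τ : Config d) {j : Site d} (h : j ∈ Λ) :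
    patch Λ σ τ j = σ ⟨j, h⟩ := by simp [patch, h]

lemma patch_not_mem (Λ : Finset (Site d)) (σ : ↥Λ → Spin) (τ : Config d) {j : Site d}
    (h : j ∉ Λ) : patch Λ σ τ j = τ j := by simp [patch, h]

lemma patch_mono (Λ : Finset (Site d)) {σ σ' : ↥Λ → Spin} {τ τ' : Config d} (h : σ ≤ σ')
    (h' : τ ≤ τ') : patch Λ σ τ ≤ patch Λ σ' τ' := by
  intro j
  by_cases hj : j ∈ Λ
  · rw [patch_mem _ _ _ hj, patch_mem _ _ _ hj]; exact h _
  · rw [patch_not_mem _ _ _ hj, patch_not_mem _ _ _ hj]; exact h' _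

/-- restriction of a configuration -/
def res (F : Finset (Site d)) (σ : Config d) : ↥F → Spin := fun k => σ k

lemma res_mono (F : Finset (Site d)) : Monotone (res F) := fun _ _ h k => h k

@[simp] lemma res_patch (F : Finset (Site d)) (ζ : ↥F → Spin) (τ : Config d) :
    res F (patch F ζ τ) = ζ := by
  ext k; simp [res, patch]

lemma DepOn.eq_comp {F : Finset (Site d)} {f : Config d → ℝ} (h : DepOn F f) :
    f = fun σ => (fun ζ => f (patch F ζ (cMinus d))) (res F σ) := by
  ext σ
  apply h
  intro k hk
  rw [patch_mem _ _ _ hk]; rfl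

lemma depOn_comp (F : Finset (Site d)) (u : (↥F → Spin) → ℝ) : DepOn F (fun σ => u (res F σ)) := by
  intro σ η h
  have : res F σ = res F η := by ext k; simp [res, h k k.2]
  simp only [this]

lemma measurable_res (F : Finset (Site d)) : Measurable (res F) :=
  measurable_pi_lambda _ fun _ => measurable_pi_apply _

lemma continuous_res (F : Finset (Site d)) : Continuous (res F) :=
  continuous_pi fun _ => continuous_apply _

lemma DepOn.measurable {F : Finset (Site d)} {f : Config d → ℝ} (h : DepOn F f) :
    Measurable f := by
  rw [h.eq_comp]
  exact (measurable_of_finite (fun ζ => f (patch F ζ (cMinus d)))).comp (measurable_res F)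

lemma DepOn.continuous {F : Finset (Site d)} {f : Config d → ℝ} (h : DepOn F f) :
    Continuous f := by
  rw [h.eq_comp]
  exact (continuous_of_discreteTopology (f := fun ζ => f (patch F ζ (cMinus d)))).comp
    (continuous_res F)

lemma DepOn.bdd {F : Finset (Site d)} {f : Config d → ℝ} (h : DepOn F f) :
    ∃ C, ∀ σ, |f σ| ≤ C := by
  refine ⟨∑ ζ, |f (patch F ζ (cMinus d))|, fun σ => ?_⟩
  rw [h.eq_comp]
  simp only [res_patch]
  exact Finset.single_le_sum (f := fun ζ => |f (patch F ζ (cMinus d))|) (fun _ _ => abs_nonneg _)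
    (Finset.mem_univ (res F σ))

lemma DepOn.integrable {F : Finset (Site d)} {f : Config d → ℝ} (h : DepOn F f)
    (μ : Measure (Config d)) [IsFiniteMeasure μ] : Integrable f μ := by
  obtain ⟨C, hC⟩ := h.bdd
  exact Integrable.of_bound h.measurable.aestronglyMeasurable C
    (Filter.Eventually.of_forall fun σ => by simpa using hC σ)

lemma cyl_eq (F : Finset (Site d)) (ζ : Config d) : cylinder F ζ = res F ⁻¹' {res F ζ} := by
  ext σ
  simp only [cylinder, Set.mem_ofPred_eq, Set.mem_preimage, Set.mem_singleton_iff]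
  constructor
  · intro h; ext k; simp [res, h k k.2]
  · intro h k hk; exact congrFun h ⟨k, hk⟩

lemma measurableSet_cylinder (F : Finset (Site d)) (ζ : Config d) :
    MeasurableSet (cylinder F ζ) := by
  rw [cyl_eq]; exact measurable_res F (measurableSet_singleton _)

/-- one step operator formula -/
lemma step_formula {β : ℝ} {K : Site d → ℝ} {R : ℕ} (hK : SymmFiniteRange K R)
    {P : Kernel (Config d) (Config d)} [IsMarkovKernel P]
    (hP : IsClassCKernel β K P) (F : Finset (Site d)) (u : (↥F → Spin) → ℝ) (η : Config d) :
    ∫ x, u (res F x) ∂(P η) = ∑ ζ : ↥F → Spin, (∏ k : ↥F, upd β K k η (ζ k)) * u ζ := by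
  have hm := measurable_res F
  have h1 : ∫ x, u (res F x) ∂(P η) = ∫ ζ, u ζ ∂((P η).map (res F)) := by
    rw [integral_map hm.aemeasurable]
    exact (measurable_of_finite u).aestronglyMeasurable
  have : IsProbabilityMeasure ((P η).map (res F)) := Measure.isProbabilityMeasure_map hm.aemeasurable
  rw [h1, integral_fintype Integrable.of_finite]
  refine Finset.sum_congr rfl fun ζ _ => ?_
  rw [smul_eq_mul, Measure.real, Measure.map_apply hm (measurableSet_singleton _)]
  have e : res F ⁻¹' {ζ} = cylinder F (patch F ζ (cMinus d)) := by rw [cyl_eq]; simp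
  rw [e, hP η F, ENNReal.toReal_prod, ← Finset.prod_coe_sort F]
  congr 1
  refine Finset.prod_congr rfl fun k _ => ?_
  rw [ENNReal.toReal_ofReal (upd_pos hK _ _ _ _).le, patch_mem _ _ _ k.2]

lemma meas_ext {μ ν : Measure (Config d)} [IsProbabilityMeasure μ] [IsProbabilityMeasure ν]
    (h : ∀ (F : Finset (Site d)) (u : (↥F → Spin) → ℝ), ∫ x, u (res F x) ∂μ = ∫ x, u (res F x) ∂ν) :
    μ = ν := by
  have hmap : ∀ F : Finset (Site d), μ.map (res F) = ν.map (res F) := by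
    intro F
    have hm := measurable_res F
    have : IsProbabilityMeasure (μ.map (res F)) := Measure.isProbabilityMeasure_map hm.aemeasurable
    have : IsProbabilityMeasure (ν.map (res F)) := Measure.isProbabilityMeasure_map hm.aemeasurable
    have key : ∀ u : (↥F → Spin) → ℝ, ∫ ζ, u ζ ∂(μ.map (res F)) = ∫ ζ, u ζ ∂(ν.map (res F)) := by
      intro u
      rw [integral_map hm.aemeasurable (measurable_of_finite u).aestronglyMeasurable,
        integral_map hm.aemeasurable (measurable_of_finite u).aestronglyMeasurable, h]
    refine Measure.ext_of_singleton fun ζ => ?_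
    have := key (Set.indicator {ζ} 1)
    rw [integral_indicator_one (measurableSet_singleton _),
      integral_indicator_one (measurableSet_singleton _)] at this
    exact (measureReal_eq_measureReal_iff).1 this
  have hp : IsProjectiveLimit μ (fun F : Finset (Site d) => ν.map F.restrict) := by
    intro F
    exact hmap F
  have hp' : IsProjectiveLimit ν (fun F : Finset (Site d) => ν.map F.restrict) := fun F => rfl
  have : ∀ F : Finset (Site d), IsFiniteMeasure (ν.map F.restrict) := fun F => inferInstance
  exact hp.unique hp'

lemma iter_prob (P : Kernel (Config d) (Config d)) [IsMarkovKernel P] (n : ℕ) (σ : Config d) :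
    IsProbabilityMeasure (iter P n σ) := by
  induction n with
  | zero => unfold iter; infer_instance
  | succ n ih => unfold iter; infer_instance

instance (P : Kernel (Config d) (Config d)) [IsMarkovKernel P] (n : ℕ) (σ : Config d) :
    IsProbabilityMeasure (iter P n σ) := iter_prob P n σ

/-- the R-neighbourhood -/
noncomputable def nbh (R : ℕ) (F : Finset (Site d)) : Finset (Site d) :=
  F.biUnion fun k => (ball d R).image fun j => k + j

lemma mem_nbh {R : ℕ} {F : Finset (Site d)} {k j : Site d} (hk : k ∈ F) (hj : j ∈ ball d R) :
    k + j ∈ nbh R F := by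
  simp only [nbh, Finset.mem_biUnion, Finset.mem_image]
  exact ⟨k, hk, j, hj, rfl⟩

section dyn
variable {β : ℝ} {K : Site d → ℝ} {R : ℕ} (hK : SymmFiniteRange K R)
    {P : Kernel (Config d) (Config d)} [IsMarkovKernel P]
    (hP : IsClassCKernel β K P)

lemma step_dep (hK : SymmFiniteRange K R) (hP : IsClassCKernel β K P)
    {F : Finset (Site d)} {f : Config d → ℝ} (h : DepOn F f) :
    DepOn (nbh R F) (fun η => ∫ x, f x ∂(P η)) := by
  intro σ η hs
  simp only
  rw [h.eq_comp]
  rw [step_formula hK hP F, step_formula hK hP F]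
  refine Finset.sum_congr rfl fun ζ _ => ?_
  congr 1
  refine Finset.prod_congr rfl fun k _ => ?_
  exact upd_congr hK β k (fun j hj => hs _ (mem_nbh k.2 hj)) _

lemma step_mono (hK : SymmFiniteRange K R) (hP : IsClassCKernel β K P)
    (hβ : 0 < β) (hKpos : ∀ k, 0 ≤ K k) {F : Finset (Site d)} {f : Config d → ℝ}
    (h : DepOn F f) (hf : Monotone f) : Monotone (fun η => ∫ x, f x ∂(P η)) := by
  intro σ η hs
  simp only
  rw [h.eq_comp]
  rw [step_formula hK hP F, step_formula hK hP F]
  exact prod_mono (fun (k : ↥F) s => upd β K k σ s) (fun k s => upd β K k η s)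
    (fun k s => (upd_pos hK _ _ _ _).le) (fun k s => (upd_pos hK _ _ _ _).le)
    (fun k => upd_sum _ _ _ _) (fun k => upd_sum _ _ _ _) (fun k => upd_mono hK hβ hKpos k hs) _
    (fun a b hab => hf (patch_mono F hab le_rfl))

lemma integral_bind' {F : Finset (Site d)} {f : Config d → ℝ} (h : DepOn F f)
    (μ : Measure (Config d)) [IsProbabilityMeasure μ] :
    ∫ x, f x ∂(μ.bind fun η => P η) = ∫ η, (∫ x, f x ∂(P η)) ∂μ := by
  have : IsProbabilityMeasure (μ.bind fun η => P η) := by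
    change IsProbabilityMeasure (μ.bind P); infer_instance
  have e : (P ∘ₖ Kernel.const Unit μ) () = μ.bind fun η => P η := by
    rw [Kernel.comp_apply]; rfl
  rw [← e]
  rw [Kernel.integral_comp (by rw [e]; exact h.integrable _)]
  rfl

lemma iter_succ {F : Finset (Site d)} {f : Config d → ℝ} (h : DepOn F f) (n : ℕ) (σ : Config d) :
    ∫ x, f x ∂(iter P (n + 1) σ) = ∫ η, (∫ x, f x ∂(P η)) ∂(iter P n σ) := by
  rw [iter]; exact integral_bind' h _

lemma iter_dep (hK : SymmFiniteRange K R) (hP : IsClassCKernel β K P)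
    (n : ℕ) : ∀ {F : Finset (Site d)} {f : Config d → ℝ} (_ : DepOn F f),
    ∃ F', DepOn F' (fun η => ∫ x, f x ∂(iter P n η)) := by
  induction n with
  | zero =>
    intro F f h
    refine ⟨F, ?_⟩
    simpa [iter] using h
  | succ n ih =>
    intro F f h
    simp only [iter_succ h]
    exact ih (step_dep hK hP h)

lemma iter_mono (hK : SymmFiniteRange K R) (hP : IsClassCKernel β K P)
    (hβ : 0 < β) (hKpos : ∀ k, 0 ≤ K k) (n : ℕ) :
    ∀ {F : Finset (Site d)} {f : Config d → ℝ} (_ : DepOn F f) (_ : Monotone f),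
    Monotone (fun η => ∫ x, f x ∂(iter P n η)) := by
  induction n with
  | zero =>
    intro F f h hf
    simpa [iter] using hf
  | succ n ih =>
    intro F f h hf
    simp only [iter_succ h]
    exact ih (step_dep hK hP h) (step_mono hK hP hβ hKpos h hf)

lemma iter_add (hK : SymmFiniteRange K R) (hP : IsClassCKernel β K P)
    (m n : ℕ) : ∀ {F : Finset (Site d)} {f : Config d → ℝ} (_ : DepOn F f)
    (σ : Config d),
    ∫ x, f x ∂(iter P (m + n) σ) = ∫ η, (∫ x, f x ∂(iter P n η)) ∂(iter P m σ) := by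
  induction n with
  | zero => intro F f h σ; simp [iter]
  | succ n ih =>
    intro F f h σ
    simp only [← add_assoc, iter_succ h]
    exact ih (step_dep hK hP h) σ

lemma stat_iter (hK : SymmFiniteRange K R) (hP : IsClassCKernel β K P)
    {ν : Measure (Config d)} [IsProbabilityMeasure ν]
    (hν : ν.bind (fun η => P η) = ν) (n : ℕ) : ∀ {F : Finset (Site d)} {f : Config d → ℝ}
    (_ : DepOn F f), ∫ η, (∫ x, f x ∂(iter P n η)) ∂ν = ∫ x, f x ∂ν := by
  induction n with
  | zero => intro F f h; simp [iter]
  | succ n ih =>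
    intro F f h
    simp only [iter_succ h]
    rw [ih (step_dep hK hP h), ← integral_bind' h, hν]

/-- translation -/
def shift (a : Site d) : Config d ≃ᵐ Config d where
  toFun σ := fun k => σ (k + a)
  invFun σ := fun k => σ (k - a)
  left_inv σ := by ext k; simp
  right_inv σ := by ext k; simp
  measurable_toFun := measurable_pi_lambda _ fun _ => measurable_pi_apply _
  measurable_invFun := measurable_pi_lambda _ fun _ => measurable_pi_apply _

lemma shift_apply (a : Site d) (σ : Config d) (k : Site d) : shift a σ k = σ (k + a) := rfl

lemma map_shift (hK : SymmFiniteRange K R) (hP : IsClassCKernel β K P)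
    (a : Site d) (η : Config d) : (P η).map (shift a) = P (shift a η) := by
  have : IsProbabilityMeasure ((P η).map (shift a)) :=
    Measure.isProbabilityMeasure_map (shift a).measurable.aemeasurable
  apply meas_ext
  intro F u
  have hm := measurable_res F
  rw [integral_map_equiv (shift a), step_formula hK hP]
  let F' : Finset (Site d) := F.image (fun k => k + a)
  let e : ↥F ≃ ↥F' := Equiv.ofBijective (fun k => ⟨k + a, Finset.mem_image_of_mem _ k.2⟩) (by
    constructor
    · intro x y h
      ext1
      simpa using h
    · rintro ⟨y, hy⟩
      obtain ⟨x, hx, rfl⟩ := Finset.mem_image.1 hy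
      exact ⟨⟨x, hx⟩, rfl⟩)
  have h1 : ∀ x, res F (shift a x) = (res F' x) ∘ e := by
    intro x; ext k; rfl
  simp only [h1]
  rw [step_formula hK hP F' (fun ζ => u (ζ ∘ e))]
  rw [← Equiv.sum_comp (e.arrowCongr (Equiv.refl Spin))]
  refine Finset.sum_congr rfl fun ζ _ => ?_
  have h2 : ((e.arrowCongr (Equiv.refl Spin)) ζ) ∘ e = ζ := by
    ext k; simp
  rw [h2]
  congr 1
  rw [← Equiv.prod_comp e]
  refine Finset.prod_congr rfl fun k _ => ?_
  have : ((e.arrowCongr (Equiv.refl Spin)) ζ) (e k) = ζ k := congrFun h2 k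
  rw [this]
  have h3 : ((e k : ↥F') : Site d) = k + a := rfl
  rw [h3, upd, upd, field_eq hK, field_eq hK]
  congr 4
  unfold fld hsum
  simp only [shift_apply, add_right_comm]

lemma iter_shift (hK : SymmFiniteRange K R) (hP : IsClassCKernel β K P)
    (a : Site d) (n : ℕ) (η : Config d) : ∀ (f : Config d → ℝ) (F : Finset (Site d))
    (F' : Finset (Site d)), DepOn F f → DepOn F' (fun x => f (shift a x)) →
    ∫ x, f (shift a x) ∂(iter P n η) = ∫ x, f x ∂(iter P n (shift a η)) := by
  induction n with
  | zero => intro f F F' h h'; simp [iter]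
  | succ n ih =>
    intro f F F' h h'
    rw [iter_succ h', iter_succ h]
    have : ∀ ξ, ∫ x, f (shift a x) ∂(P ξ) = ∫ x, f x ∂(P (shift a ξ)) := by
      intro ξ
      rw [← map_shift hK hP, integral_map_equiv (shift a)]
    have h2 := step_dep hK hP h'
    simp only [this] at h2 ⊢
    exact ih (fun ξ => ∫ x, f x ∂(P ξ)) _ _ (step_dep hK hP h) h2

lemma dep_spin (k : Site d) : DepOn {k} (fun σ => (σ k : ℝ)) := by
  intro σ η h; simp [h k]

lemma iter_spin (hK : SymmFiniteRange K R) (hP : IsClassCKernel β K P)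
    (k : Site d) (n : ℕ) (η : Config d) (hη : ∀ a, shift a η = η) :
    ∫ x, (x k : ℝ) ∂(iter P n η) = ∫ x, (x 0 : ℝ) ∂(iter P n η) := by
  have := iter_shift hK hP k n η (fun x => (x 0 : ℝ)) {0} {k} (dep_spin 0)
    (by simpa [shift_apply] using dep_spin k)
  simpa [shift_apply, hη] using this

end dyn
end ClassC

namespace ClassC
variable {d : ℕ}

/-- finite volume operator -/
noncomputable def Qop (β : ℝ) (K : Site d → ℝ) (Λ : Finset (Site d)) (τ : Config d)
    (u : (↥Λ → Spin) → ℝ) : (↥Λ → Spin) → ℝ :=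
  fun η => ∑ ζ, fvKer β K Λ τ η ζ * u ζ

section fv
variable {β : ℝ} {K : Site d → ℝ} {R : ℕ} (hK : SymmFiniteRange K R)
  (Λ : Finset (Site d)) (τ : Config d)

lemma fvKer_pos (hK : SymmFiniteRange K R) (Λ : Finset (Site d)) (τ : Config d)
    (η ζ : ↥Λ → Spin) : 0 < fvKer β K Λ τ η ζ :=
  Finset.prod_pos fun _ _ => upd_pos hK _ _ _ _

lemma fvKer_sum (η : ↥Λ → Spin) : ∑ ζ, fvKer β K Λ τ η ζ = 1 := by
  unfold fvKer
  rw [← Fintype.prod_sum (fun (k : ↥Λ) s => upd β K k (patch Λ η τ) s)]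
  exact Finset.prod_eq_one fun k _ => by rw [sum_spin, upd_sum]

lemma Q_mono (hK : SymmFiniteRange K R) (Λ : Finset (Site d)) (τ : Config d)
    (hβ : 0 < β) (hKpos : ∀ k, 0 ≤ K k) {u : (↥Λ → Spin) → ℝ} (hu : Monotone u) :
    Monotone (Qop β K Λ τ u) := by
  intro a b hab
  unfold Qop fvKer
  exact prod_mono (fun (k : ↥Λ) s => upd β K k (patch Λ a τ) s)
    (fun k s => upd β K k (patch Λ b τ) s)
    (fun k s => (upd_pos hK _ _ _ _).le) (fun k s => (upd_pos hK _ _ _ _).le)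
    (fun k => upd_sum _ _ _ _) (fun k => upd_sum _ _ _ _)
    (fun k => upd_mono hK hβ hKpos k (patch_mono Λ hab le_rfl)) u hu

lemma Qn_mono (hK : SymmFiniteRange K R) (Λ : Finset (Site d)) (τ : Config d)
    (hβ : 0 < β) (hKpos : ∀ k, 0 ≤ K k) (n : ℕ) {u : (↥Λ → Spin) → ℝ} (hu : Monotone u) :
    Monotone ((Qop β K Λ τ)^[n] u) := by
  induction n with
  | zero => simpa using hu
  | succ n ih => rw [Function.iterate_succ_apply']; exact Q_mono hK Λ τ hβ hKpos ih

lemma iter_one (P : Kernel (Config d) (Config d)) (η : Config d) : iter P 1 η = P η := by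
  simp only [iter]
  exact Measure.dirac_bind P.measurable η

variable {P : Kernel (Config d) (Config d)} [IsMarkovKernel P] (hP : IsClassCKernel β K P)

lemma iter_le_Q (hK : SymmFiniteRange K R) (Λ : Finset (Site d)) (hP : IsClassCKernel β K P)
    (hβ : 0 < β) (hKpos : ∀ k, 0 ≤ K k) (n : ℕ) {u : (↥Λ → Spin) → ℝ} (hu : Monotone u) :
    ∀ η : Config d, ∫ x, u (res Λ x) ∂(iter P n η) ≤ ((Qop β K Λ (cPlus d))^[n] u) (res Λ η) := by
  induction n with
  | zero => intro η; simp [iter]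
  | succ n ih =>
    intro η
    have hd := depOn_comp Λ u
    obtain ⟨F', hF'⟩ := iter_dep hK hP n hd
    rw [add_comm n 1, iter_add hK hP 1 n hd, iter_one, add_comm 1 n, Function.iterate_succ_apply']
    refine (integral_mono (hF'.integrable _) ((depOn_comp Λ _).integrable _) ih).trans ?_
    rw [step_formula hK hP]
    unfold Qop fvKer
    refine prod_mono (fun (k : ↥Λ) s => upd β K k η s)
      (fun k s => upd β K k (patch Λ (res Λ η) (cPlus d)) s)
      (fun k s => (upd_pos hK _ _ _ _).le) (fun k s => (upd_pos hK _ _ _ _).le)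
      (fun k => upd_sum _ _ _ _) (fun k => upd_sum _ _ _ _)
      (fun k => upd_mono hK hβ hKpos k ?_) _ (Qn_mono hK Λ _ hβ hKpos n hu)
    intro j
    by_cases hj : j ∈ Λ
    · rw [patch_mem _ _ _ hj]; exact le_rfl
    · rw [patch_not_mem _ _ _ hj]; exact le_sPlus _

lemma Q_le_iter (hK : SymmFiniteRange K R) (Λ : Finset (Site d)) (hP : IsClassCKernel β K P)
    (hβ : 0 < β) (hKpos : ∀ k, 0 ≤ K k) (n : ℕ) {u : (↥Λ → Spin) → ℝ} (hu : Monotone u) :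
    ∀ η : Config d, ((Qop β K Λ (cMinus d))^[n] u) (res Λ η) ≤ ∫ x, u (res Λ x) ∂(iter P n η) := by
  induction n with
  | zero => intro η; simp [iter]
  | succ n ih =>
    intro η
    have hd := depOn_comp Λ u
    obtain ⟨F', hF'⟩ := iter_dep hK hP n hd
    rw [add_comm n 1, iter_add hK hP 1 n hd, iter_one, add_comm 1 n, Function.iterate_succ_apply']
    refine le_trans ?_ (integral_mono ((depOn_comp Λ _).integrable _) (hF'.integrable _) ih)
    rw [step_formula hK hP]
    unfold Qop fvKer
    refine prod_mono 
      (fun (k : ↥Λ) s => upd β K k (patch Λ (res Λ η) (cMinus d)) s) (fun (k : ↥Λ) s => upd β K k η s)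
      (fun k s => (upd_pos hK _ _ _ _).le) (fun k s => (upd_pos hK _ _ _ _).le)
      (fun k => upd_sum _ _ _ _) (fun k => upd_sum _ _ _ _)
      (fun k => upd_mono hK hβ hKpos k ?_) _ (Qn_mono hK Λ _ hβ hKpos n hu)
    intro j
    by_cases hj : j ∈ Λ
    · rw [patch_mem _ _ _ hj]; exact le_rfl
    · rw [patch_not_mem _ _ _ hj]; exact sMinus_le _

/-- boundary field -/
noncomputable def bd (β : ℝ) (K : Site d → ℝ) (R : ℕ) (Λ : Finset (Site d)) (τ : Config d)
    (k : Site d) : ℝ := β * hsum K R k (fun j => if j ∈ Λ then 0 else (τ j : ℝ))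

/-- reversible weight -/
noncomputable def wt (β : ℝ) (K : Site d → ℝ) (R : ℕ) (Λ : Finset (Site d)) (τ : Config d)
    (σ : ↥Λ → Spin) : ℝ :=
  ∏ k : ↥Λ, (Real.cosh (fld β K R k (patch Λ σ τ)) * Real.exp (σ k * bd β K R Λ τ k))

lemma wt_pos (β : ℝ) (K : Site d → ℝ) (R : ℕ) (σ : ↥Λ → Spin) : 0 < wt β K R Λ τ σ :=
  Finset.prod_pos fun _ _ => mul_pos (Real.cosh_pos _) (Real.exp_pos _)

lemma fld_patch (hK : SymmFiniteRange K R) (Λ : Finset (Site d)) (τ : Config d)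
    (k : Site d) (η : ↥Λ → Spin) :
    fld β K R k (patch Λ η τ) = β * (∑ l : ↥Λ, K (l - k) * (η l : ℝ)) + bd β K R Λ τ k := by
  have e : (fun j => ((patch Λ η τ j : Spin) : ℝ)) =
      (fun j => if h : j ∈ Λ then (η ⟨j, h⟩ : ℝ) else 0) +
        (fun j => if j ∈ Λ then 0 else (τ j : ℝ)) := by
    ext j
    by_cases hj : j ∈ Λ <;> simp [patch, hj]
  rw [fld, e, hsum_add, mul_add, bd, hsum_supp hK k Λ _ (by intro j hj; simp [hj])]
  simp

lemma detailed (hK : SymmFiniteRange K R) (Λ : Finset (Site d)) (τ : Config d)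
    (η σ : ↥Λ → Spin) :
    wt β K R Λ τ η * fvKer β K Λ τ η σ = wt β K R Λ τ σ * fvKer β K Λ τ σ η := by
  have key : ∀ a b : ↥Λ → Spin, wt β K R Λ τ a * fvKer β K Λ τ a b =
      (∏ _k : ↥Λ, (1 / 2 : ℝ)) * Real.exp (∑ k : ↥Λ, ((a k : ℝ) * bd β K R Λ τ k +
        (b k : ℝ) * bd β K R Λ τ k) + β * ∑ k : ↥Λ, ∑ l : ↥Λ, K (l - k) * (a l : ℝ) * (b k : ℝ)) := by
    intro a b
    rw [Finset.mul_sum, ← Finset.sum_add_distrib, Real.exp_sum, ← Finset.prod_mul_distrib,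
      wt, fvKer, ← Finset.prod_mul_distrib]
    refine Finset.prod_congr rfl fun k _ => ?_
    rw [upd_eq hK]
    have hc := Real.cosh_pos (fld β K R k (patch Λ a τ))
    have e : Real.exp ((b k : ℝ) * fld β K R k (patch Λ a τ)) * Real.exp (a k * bd β K R Λ τ k) =
      Real.exp ((a k : ℝ) * bd β K R Λ τ k + (b k : ℝ) * bd β K R Λ τ k +
        β * ∑ l : ↥Λ, K (l - k) * (a l : ℝ) * (b k : ℝ)) := by
      rw [← Real.exp_add]
      congr 1
      rw [fld_patch hK, ← Finset.sum_mul]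
      ring
    rw [← e]
    field_simp
  rw [key, key]
  congr 2
  congr 1
  · exact Finset.sum_congr rfl fun k _ => add_comm _ _
  · congr 1
    rw [Finset.sum_comm]
    refine Finset.sum_congr rfl fun k _ => Finset.sum_congr rfl fun l _ => ?_
    rw [← hK.1, neg_sub]; ring

lemma stat_Q (hK : SymmFiniteRange K R) (Λ : Finset (Site d)) (τ : Config d)
    (u : (↥Λ → Spin) → ℝ) :
    ∑ η, wt β K R Λ τ η * Qop β K Λ τ u η = ∑ η, wt β K R Λ τ η * u η := by
  unfold Qop
  simp only [Finset.mul_sum, ← mul_assoc]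
  rw [Finset.sum_comm]
  refine Finset.sum_congr rfl fun ζ _ => ?_
  rw [← Finset.sum_mul, Finset.sum_congr rfl fun η _ => detailed hK Λ τ η ζ, ← Finset.mul_sum,
    fvKer_sum, mul_one]

/-- reversible expectation -/
noncomputable def nuE (β : ℝ) (K : Site d → ℝ) (R : ℕ) (Λ : Finset (Site d)) (τ : Config d)
    (u : (↥Λ → Spin) → ℝ) : ℝ := (∑ σ, wt β K R Λ τ σ * u σ) / ∑ σ, wt β K R Λ τ σ

lemma Z_pos (β : ℝ) (K : Site d → ℝ) (R : ℕ) : 0 < ∑ σ, wt β K R Λ τ σ :=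
  Finset.sum_pos (fun _ _ => wt_pos _ _ _ _ _ _) ⟨fun _ => sPlus, Finset.mem_univ _⟩

lemma nuE_mono {u v : (↥Λ → Spin) → ℝ} (h : ∀ σ, u σ ≤ v σ) :
    nuE β K R Λ τ u ≤ nuE β K R Λ τ v :=
  div_le_div_of_nonneg_right (Finset.sum_le_sum fun σ _ =>
    mul_le_mul_of_nonneg_left (h σ) (wt_pos _ _ _ _ _ _).le) (Z_pos _ _ _ _ _).le

lemma nuE_const (c : ℝ) : nuE β K R Λ τ (fun _ => c) = c := by
  rw [nuE, ← Finset.sum_mul]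
  field_simp [(Z_pos Λ τ β K R).ne']

lemma nuE_Qn (hK : SymmFiniteRange K R) (Λ : Finset (Site d)) (τ : Config d)
    (n : ℕ) (u : (↥Λ → Spin) → ℝ) :
    nuE β K R Λ τ ((Qop β K Λ τ)^[n] u) = nuE β K R Λ τ u := by
  induction n with
  | zero => rfl
  | succ n ih => rw [Function.iterate_succ_apply', ← ih, nuE, nuE, stat_Q hK]

lemma nuE_le_Qn (hK : SymmFiniteRange K R) (Λ : Finset (Site d)) (τ : Config d)
    (hβ : 0 < β) (hKpos : ∀ k, 0 ≤ K k) (n : ℕ) {u : (↥Λ → Spin) → ℝ}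
    (hu : Monotone u) : nuE β K R Λ τ u ≤ ((Qop β K Λ τ)^[n] u) (fun _ => sPlus) := by
  rw [← nuE_Qn hK Λ τ n]
  refine (nuE_mono Λ τ fun σ => ?_).trans_eq (nuE_const Λ τ _)
  exact Qn_mono hK Λ τ hβ hKpos n hu fun _ => le_sPlus _

lemma Qn_le_nuE (hK : SymmFiniteRange K R) (Λ : Finset (Site d)) (τ : Config d)
    (hβ : 0 < β) (hKpos : ∀ k, 0 ≤ K k) (n : ℕ) {u : (↥Λ → Spin) → ℝ}
    (hu : Monotone u) : ((Qop β K Λ τ)^[n] u) (fun _ => sMinus) ≤ nuE β K R Λ τ u := by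
  rw [← nuE_Qn hK Λ τ n u]
  refine (nuE_const (R := R) (β := β) (K := K) Λ τ _).symm.trans_le (nuE_mono Λ τ fun σ => ?_)
  exact Qn_mono hK Λ τ hβ hKpos n hu fun _ => sMinus_le _

lemma Q_contr (hK : SymmFiniteRange K R) (Λ : Finset (Site d)) (τ : Config d)
    (hβ : 0 < β) (hKpos : ∀ k, 0 ≤ K k) :
    ∃ r : ℝ, 0 ≤ r ∧ r < 1 ∧ ∀ u : (↥Λ → Spin) → ℝ, Monotone u → ∀ n : ℕ,
      ((Qop β K Λ τ)^[n] u) (fun _ => sPlus) - ((Qop β K Λ τ)^[n] u) (fun _ => sMinus) ≤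
        r ^ n * (u (fun _ => sPlus) - u (fun _ => sMinus)) := by
  let e := fvKer β K Λ τ (fun _ => sPlus) (fun _ => sMinus)
  have he : 0 < e := fvKer_pos hK Λ τ _ _
  have hsum := fvKer_sum (β := β) (K := K) Λ τ (fun _ => sPlus)
  have he1 : e ≤ 1 := by
    rw [← hsum]
    exact Finset.single_le_sum (f := fun ζ => fvKer β K Λ τ (fun _ => sPlus) ζ)
      (fun ζ _ => (fvKer_pos hK Λ τ _ _).le) (Finset.mem_univ _)
  refine ⟨1 - e, by linarith, by linarith, fun u hu n => ?_⟩
  induction n with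
  | zero => simp
  | succ n ih =>
    have hm := Qn_mono hK Λ τ hβ hKpos n hu
    set v := (Qop β K Λ τ)^[n] u with hv
    rw [Function.iterate_succ_apply', ← hv, pow_succ', mul_assoc]
    refine le_trans ?_ (mul_le_mul_of_nonneg_left ih (by linarith))
    have h1 : v (fun _ => sMinus) ≤ Qop β K Λ τ v (fun _ => sMinus) := by
      have : v (fun _ => sMinus) = ∑ ζ, fvKer β K Λ τ (fun _ => sMinus) ζ * v (fun _ => sMinus) := by
        rw [← Finset.sum_mul, fvKer_sum, one_mul]
      rw [this]
      exact Finset.sum_le_sum fun ζ _ => mul_le_mul_of_nonneg_left (hm fun _ => sMinus_le _)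
        (fvKer_pos hK Λ τ _ _).le
    have h2 : Qop β K Λ τ v (fun _ => sPlus) ≤ v (fun _ => sPlus) -
        e * (v (fun _ => sPlus) - v (fun _ => sMinus)) := by
      have h3 : e * (v (fun _ => sPlus) - v (fun _ => sMinus)) ≤
          ∑ ζ, fvKer β K Λ τ (fun _ => sPlus) ζ * (v (fun _ => sPlus) - v ζ) :=
        Finset.single_le_sum
          (f := fun ζ => fvKer β K Λ τ (fun _ => sPlus) ζ * (v (fun _ => sPlus) - v ζ))
          (fun ζ _ => mul_nonneg (fvKer_pos hK Λ τ _ _).le (sub_nonneg.2 (hm fun _ => le_sPlus _)))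
          (Finset.mem_univ (fun _ => sMinus))
      simp only [mul_sub, Finset.sum_sub_distrib, ← Finset.sum_mul, hsum, one_mul] at h3
      unfold Qop
      linarith
    linarith

end fv

lemma holley' {α : Type*} [DistribLattice α] [Fintype α] (f g u : α → ℝ)
    (hf : ∀ a, 0 ≤ f a) (hg : ∀ a, 0 ≤ g a) (hF : 0 < ∑ a, f a) (hG : 0 < ∑ a, g a)
    (hu : Monotone u) (h : ∀ a b, f a * g b ≤ f (a ⊓ b) * g (a ⊔ b)) :
    (∑ a, f a * u a) / ∑ a, f a ≤ (∑ a, g a * u a) / ∑ a, g a := by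
  set F := ∑ a, f a
  set G := ∑ a, g a
  have key := holley (μ := fun a => u a + ∑ b, |u b|) (f := fun a => f a / F) (g := fun a => g a / G)
    (fun a => by
      have h1 := Finset.single_le_sum (f := fun a => |u a|) (fun _ _ => abs_nonneg _)
        (Finset.mem_univ a)
      have h2 := neg_abs_le (u a)
      simp only [Pi.zero_apply] at *
      linarith)
    (fun a => div_nonneg (hf a) hF.le) (fun a => div_nonneg (hg a) hG.le)
    (fun a b hab => by have := hu hab; simp only; linarith)
    (by rw [← Finset.sum_div, ← Finset.sum_div, div_self hF.ne', div_self hG.ne'])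
    (by
      intro a b
      rw [div_mul_div_comm, div_mul_div_comm]
      exact div_le_div_of_nonneg_right (h a b) (mul_pos hF hG).le)
  simp only [add_mul, Finset.sum_add_distrib, ← Finset.mul_sum, ← Finset.sum_div] at key
  rw [div_self hF.ne', div_self hG.ne'] at key
  rw [Finset.sum_div, Finset.sum_div]
  have e1 : ∀ a, f a * u a / F = u a * (f a / F) := fun a => by ring
  have e2 : ∀ a, g a * u a / G = u a * (g a / G) := fun a => by ring
  simp only [e1, e2]
  linarith

lemma cosh_ineq {x y a b : ℝ} (h : x + y = a + b) (h1 : x ≤ a) (h2 : x ≤ b) :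
    Real.cosh a * Real.cosh b ≤ Real.cosh x * Real.cosh y := by
  have id : ∀ s t : ℝ, Real.cosh s * Real.cosh t = (Real.cosh (s + t) + Real.cosh (s - t)) / 2 := by
    intro s t; rw [Real.cosh_add, Real.cosh_sub]; ring
  rw [id, id, h]
  have : Real.cosh (a - b) ≤ Real.cosh (x - y) := by
    rw [Real.cosh_le_cosh]
    rw [abs_le, abs_of_nonpos (by linarith)]
    constructor <;> linarith
  linarith

lemma spin_inf_sup (a b : Spin) : ((a ⊓ b : Spin) : ℝ) + ((a ⊔ b : Spin) : ℝ) = a + b := by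
  rcases le_total a b with h | h
  · rw [inf_eq_left.2 h, sup_eq_right.2 h]
  · rw [inf_eq_right.2 h, sup_eq_left.2 h, add_comm]

lemma cosh_fld {β : ℝ} (hβ : 0 < β) {K : Site d → ℝ} (hKpos : ∀ k, 0 ≤ K k) (R : ℕ) (k : Site d)
    (a b : Config d) : Real.cosh (fld β K R k a) * Real.cosh (fld β K R k b) ≤
      Real.cosh (fld β K R k (a ⊓ b)) * Real.cosh (fld β K R k (a ⊔ b)) := by
  apply cosh_ineq
  · unfold fld
    rw [← mul_add, ← mul_add, ← hsum_add, ← hsum_add]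
    congr 2
    ext j
    exact spin_inf_sup _ _
  · exact fld_mono hβ hKpos R k inf_le_left
  · exact fld_mono hβ hKpos R k inf_le_right

lemma nuE_pm {β : ℝ} (hβ : 0 < β) {K : Site d → ℝ} (hKpos : ∀ k, 0 ≤ K k) (R : ℕ)
    (Λ : Finset (Site d)) {u : (↥Λ → Spin) → ℝ} (hu : Monotone u) :
    nuE β K R Λ (cMinus d) u ≤ nuE β K R Λ (cPlus d) u := by
  apply holley' _ _ _ (fun a => (wt_pos _ _ _ _ _ _).le) (fun a => (wt_pos _ _ _ _ _ _).le)
    (Z_pos _ _ _ _ _) (Z_pos _ _ _ _ _) hu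
  intro a b
  unfold wt
  rw [← Finset.prod_mul_distrib, ← Finset.prod_mul_distrib]
  refine Finset.prod_le_prod (fun k _ => ?_) fun k _ => ?_
  · have := Real.cosh_pos (fld β K R k (patch Λ a (cMinus d)))
    have := Real.cosh_pos (fld β K R k (patch Λ b (cPlus d)))
    positivity
  rw [mul_mul_mul_comm, mul_mul_mul_comm (Real.cosh (fld β K R k (patch Λ (a ⊓ b) (cMinus d))))]
  refine mul_le_mul ?_ ?_ (by positivity)
    (mul_pos (Real.cosh_pos _) (Real.cosh_pos _)).le
  · have h1 : patch Λ (a ⊓ b) (cMinus d) = patch Λ a (cMinus d) ⊓ patch Λ b (cPlus d) := by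
      ext1 j
      by_cases hj : j ∈ Λ
      · simp [patch, hj]
      · simp only [patch, hj, Pi.inf_apply, dite_false]
        exact (inf_eq_left.2 (sMinus_le _)).symm
    have h2 : patch Λ (a ⊔ b) (cPlus d) = patch Λ a (cMinus d) ⊔ patch Λ b (cPlus d) := by
      ext1 j
      by_cases hj : j ∈ Λ
      · simp [patch, hj]
      · simp only [patch, hj, Pi.sup_apply, dite_false]
        exact (sup_eq_right.2 (sMinus_le _)).symm
    rw [h1, h2]
    exact cosh_fld hβ hKpos R k _ _
  · rw [← Real.exp_add, ← Real.exp_add, Real.exp_le_exp]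
    have hb : bd β K R Λ (cMinus d) k = - bd β K R Λ (cPlus d) k := by
      unfold bd hsum
      rw [← mul_neg, ← Finset.sum_neg_distrib]
      congr 1
      refine Finset.sum_congr rfl fun j _ => ?_
      by_cases hj : (k : Site d) + j ∈ Λ <;> simp [hj, cMinus, cPlus]
    have hc : 0 ≤ bd β K R Λ (cPlus d) k := by
      unfold bd hsum
      refine mul_nonneg hβ.le (Finset.sum_nonneg fun j _ => mul_nonneg (hKpos _) ?_)
      by_cases hj : (k : Site d) + j ∈ Λ <;> simp [hj, cPlus]
    rw [hb]
    simp only [Pi.inf_apply, Pi.sup_apply]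
    rcases le_total (a k) (b k) with h | h
    · rw [inf_eq_left.2 h, sup_eq_right.2 h]
    · rw [inf_eq_right.2 h, sup_eq_left.2 h]
      have : (b k : ℝ) ≤ a k := h
      nlinarith

end ClassC

namespace ClassC
variable {d : ℕ}

/-- spin flip -/
def sNeg (s : Spin) : Spin := ⟨-(s : ℝ), by
  rcases spin_cases s with rfl | rfl <;> simp⟩

@[simp] lemma coe_sNeg (s : Spin) : ((sNeg s : Spin) : ℝ) = -(s : ℝ) := rfl

/-- spin flip on finite configurations -/
def flipE (ι : Type*) : (ι → Spin) ≃ (ι → Spin) where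
  toFun σ := fun k => sNeg (σ k)
  invFun σ := fun k => sNeg (σ k)
  left_inv σ := by ext k; simp
  right_inv σ := by ext k; simp

lemma flipE_coe {ι : Type*} (σ : ι → Spin) (k : ι) : ((flipE ι σ k : Spin) : ℝ) = -(σ k : ℝ) := rfl

lemma fld_flip (β : ℝ) (K : Site d → ℝ) (R : ℕ) (k : Site d) (Λ : Finset (Site d))
    (σ : ↥Λ → Spin) :
    fld β K R k (patch Λ (flipE _ σ) (cMinus d)) = - fld β K R k (patch Λ σ (cPlus d)) := by
  unfold fld hsum
  rw [← mul_neg, ← Finset.sum_neg_distrib]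
  congr 1
  refine Finset.sum_congr rfl fun j _ => ?_
  by_cases hj : k + j ∈ Λ
  · simp [patch, hj, flipE_coe]
  · simp [patch, hj, cMinus, cPlus]

lemma bd_flip (β : ℝ) (K : Site d → ℝ) (R : ℕ) (k : Site d) (Λ : Finset (Site d)) :
    bd β K R Λ (cMinus d) k = - bd β K R Λ (cPlus d) k := by
  unfold bd hsum
  rw [← mul_neg, ← Finset.sum_neg_distrib]
  congr 1
  refine Finset.sum_congr rfl fun j _ => ?_
  by_cases hj : (k : Site d) + j ∈ Λ <;> simp [hj, cMinus, cPlus]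

lemma wt_flip (β : ℝ) (K : Site d → ℝ) (R : ℕ) (Λ : Finset (Site d)) (σ : ↥Λ → Spin) :
    wt β K R Λ (cMinus d) (flipE _ σ) = wt β K R Λ (cPlus d) σ := by
  unfold wt
  refine Finset.prod_congr rfl fun k _ => ?_
  rw [fld_flip, Real.cosh_neg, flipE_coe, bd_flip, neg_mul_neg]

lemma nuE_flip (β : ℝ) (K : Site d → ℝ) (R : ℕ) (Λ : Finset (Site d)) (k : ↥Λ) :
    nuE β K R Λ (cMinus d) (fun σ => (σ k : ℝ)) = - nuE β K R Λ (cPlus d) (fun σ => (σ k : ℝ)) := by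
  unfold nuE
  rw [← Equiv.sum_comp (flipE _), ← Equiv.sum_comp (flipE _) (fun σ => wt β K R Λ (cMinus d) σ)]
  simp only [wt_flip, flipE_coe, mul_neg, Finset.sum_neg_distrib, neg_div]

lemma ham_eq {K : Site d → ℝ} {R : ℕ} (hK : SymmFiniteRange K R) (β : ℝ) (Δ : Finset (Site d))
    (τ : Config d) (σ : ↥Δ → Spin) : ham β K Δ τ σ =
    ∑ᶠ (k : Site d) (_ : ∃ j ∈ Δ, K (k - j) ≠ 0), -Real.log (Real.cosh (fld β K R k (patch Δ σ τ))) := by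
  unfold ham fld
  simp only [finsum_eq_hsum' hK _ (fun j => ((patch Δ σ τ j : Spin) : ℝ))]

lemma ham_flip {K : Site d → ℝ} {R : ℕ} (hK : SymmFiniteRange K R) (β : ℝ) (Δ : Finset (Site d))
    (σ : ↥Δ → Spin) : ham β K Δ (cMinus d) (flipE _ σ) = ham β K Δ (cPlus d) σ := by
  simp only [ham_eq hK, fld_flip, Real.cosh_neg]

lemma atZero_flip {K : Site d → ℝ} {R : ℕ} (hK : SymmFiniteRange K R) (β : ℝ)
    {Δ : Finset (Site d)} (h : (0 : Site d) ∈ Δ) :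
    atZero h (gibbsFV β K Δ (cMinus d)) = - atZero h (gibbsFV β K Δ (cPlus d)) := by
  unfold atZero gibbsFV
  rw [← Equiv.sum_comp (flipE _), ← Equiv.sum_comp (flipE _) (fun σ => Real.exp (-ham β K Δ (cMinus d) σ))]
  simp only [ham_flip hK, flipE_coe, mul_neg, Finset.sum_neg_distrib]

open Classical in
/-- sites whose interaction set meets the ball -/
noncomputable def Dset (K : Site d → ℝ) (R L : ℕ) : Finset (Site d) :=
  (ball d (L + R)).filter fun k => ∃ j ∈ ball d L, K (k - j) ≠ 0

lemma exp_ham {K : Site d → ℝ} {R : ℕ} (hK : SymmFiniteRange K R) (β : ℝ) (L : ℕ)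
    (τ : Config d) (σ : ↥(ball d L) → Spin) : Real.exp (-ham β K (ball d L) τ σ) =
    ∏ k ∈ Dset K R L, Real.cosh (fld β K R k (patch (ball d L) σ τ)) := by
  have hs := finsum_cond_eq_sum_of_cond_iff
    (fun k => -Real.log (Real.cosh (fld β K R k (patch (ball d L) σ τ))))
    (p := fun k => ∃ j ∈ ball d L, K (k - j) ≠ 0) (t := Dset K R L) (by
      intro k _
      simp only [Dset, Finset.mem_filter, iff_and_self]
      rintro ⟨j, hj, hkj⟩
      have : k - j ∈ ball d R := by
        by_contra h; exact hkj (K_zero hK h)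
      simpa using ball_add hj this)
  rw [ham_eq hK, hs, ← Finset.sum_neg_distrib, Real.exp_sum]
  refine Finset.prod_congr rfl fun k _ => ?_
  rw [neg_neg, Real.exp_log (Real.cosh_pos _)]

lemma nuE_le_gibbs {K : Site d → ℝ} {R : ℕ} (hK : SymmFiniteRange K R) {β : ℝ} (hβ : 0 < β)
    (hKpos : ∀ k, 0 ≤ K k) (L : ℕ) :
    nuE β K R (ball d (L + R)) (cPlus d) (fun σ => (σ ⟨0, zero_mem_ball d (L + R)⟩ : ℝ)) ≤
      atZero (zero_mem_ball d L) (gibbsFV β K (ball d L) (cPlus d)) := by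
  classical
  have hsub : ball d L ⊆ ball d (L + R) := by
    intro k hk; rw [mem_ball] at *; push_cast; linarith [(Nat.cast_nonneg R : (0 : ℤ) ≤ R)]
  set Λ := ball d (L + R) with hΛ
  set Δ := ball d L with hΔ
  let g : (↥Λ → Spin) → ℝ := fun σ => if ∀ k : ↥Λ, (k : Site d) ∉ Δ → σ k = sPlus then
    ∏ k ∈ Dset K R L, Real.cosh (fld β K R k (patch Λ σ (cPlus d))) else 0
  let e : (↥Δ → Spin) → (↥Λ → Spin) := fun σ => res Λ (patch Δ σ (cPlus d))
  have he_patch : ∀ σ, patch Λ (e σ) (cPlus d) = patch Δ σ (cPlus d) := by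
    intro σ; ext1 j
    by_cases hj : j ∈ Λ
    · rw [patch_mem _ _ _ hj]; rfl
    · rw [patch_not_mem _ _ _ hj, patch_not_mem _ _ _ (fun h => hj (hsub h))]
  have he_inj : Function.Injective e := by
    intro a b hab
    have : patch Δ a (cPlus d) = patch Δ b (cPlus d) := by rw [← he_patch, hab, he_patch]
    rw [← res_patch Δ a (cPlus d), this, res_patch]
  have hge : ∀ σ, g (e σ) = Real.exp (-ham β K Δ (cPlus d) σ) := by
    intro σ
    rw [exp_ham hK]
    simp only [g]
    rw [if_pos, he_patch]
    intro k hk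
    simp only [e, res]
    rw [patch_not_mem _ _ _ hk]; rfl
  have hgz : ∀ σ, σ ∉ Set.range e → g σ = 0 := by
    intro σ hσ
    simp only [g]
    rw [if_neg]
    intro h
    apply hσ
    refine ⟨fun k => σ ⟨k, hsub k.2⟩, ?_⟩
    ext1 k
    simp only [e, res]
    by_cases hk : (k : Site d) ∈ Δ
    · rw [patch_mem _ _ _ hk]
    · rw [patch_not_mem _ _ _ hk, h k hk]; rfl
  have hsumg : ∀ u : (↥Λ → Spin) → ℝ, ∑ σ, g σ * u σ =
      ∑ σ, Real.exp (-ham β K Δ (cPlus d) σ) * u (e σ) := by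
    intro u
    symm
    apply Fintype.sum_of_injective e he_inj
    · intro σ hσ; rw [hgz σ hσ, zero_mul]
    · intro σ; rw [hge]
  have hg0 : ∀ σ, 0 ≤ g σ := by
    intro σ; simp only [g]; split_ifs
    · exact Finset.prod_nonneg fun k _ => (Real.cosh_pos _).le
    · exact le_rfl
  have hG : ∑ σ, g σ = ∑ σ, Real.exp (-ham β K Δ (cPlus d) σ) := by
    simpa using hsumg (fun _ => 1)
  have hGpos : 0 < ∑ σ, g σ := by
    rw [hG]
    exact Finset.sum_pos (fun _ _ => Real.exp_pos _) ⟨fun _ => sPlus, Finset.mem_univ _⟩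
  have key := holley' (fun σ => wt β K R Λ (cPlus d) σ) g
    (fun σ => (σ ⟨0, zero_mem_ball d (L + R)⟩ : ℝ))
    (fun a => (wt_pos _ _ _ _ _ _).le) hg0 (Z_pos _ _ _ _ _) hGpos (fun a b hab => hab _) ?_
  · refine key.trans_eq ?_
    rw [hsumg, hG]
    unfold atZero gibbsFV
    rw [Finset.sum_div]
    refine Finset.sum_congr rfl fun σ _ => ?_
    have : e σ ⟨0, zero_mem_ball d (L + R)⟩ = σ ⟨0, zero_mem_ball d L⟩ := by
      simp only [e, res]
      rw [patch_mem _ _ _ (zero_mem_ball d L)]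
    rw [this]; ring
  · intro a b
    by_cases hb : ∀ k : ↥Λ, (k : Site d) ∉ Δ → b k = sPlus
    swap
    · have : g b = 0 := by simp only [g]; rw [if_neg hb]
      rw [this, mul_zero]
      exact mul_nonneg (wt_pos _ _ _ _ _ _).le (hg0 _)
    have hab : ∀ k : ↥Λ, (k : Site d) ∉ Δ → (a ⊔ b) k = sPlus := by
      intro k hk
      rw [Pi.sup_apply, hb k hk]; exact sup_eq_right.2 (le_sPlus _)
    have hab' : ∀ k : ↥Λ, (k : Site d) ∉ Δ → (a ⊓ b) k = a k := by
      intro k hk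
      rw [Pi.inf_apply, hb k hk]; exact inf_eq_left.2 (le_sPlus _)
    have g1 : g b = ∏ k ∈ Dset K R L, Real.cosh (fld β K R k (patch Λ b (cPlus d))) := by
      simp only [g]; rw [if_pos hb]
    have g2 : g (a ⊔ b) = ∏ k ∈ Dset K R L, Real.cosh (fld β K R k (patch Λ (a ⊔ b) (cPlus d))) := by
      simp only [g]; rw [if_pos hab]
    have hinf : patch Λ (a ⊓ b) (cPlus d) = patch Λ a (cPlus d) ⊓ patch Λ b (cPlus d) := by
      ext1 j
      by_cases hj : j ∈ Λ <;> simp [patch, hj]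
    have hsup : patch Λ (a ⊔ b) (cPlus d) = patch Λ a (cPlus d) ⊔ patch Λ b (cPlus d) := by
      ext1 j
      by_cases hj : j ∈ Λ <;> simp [patch, hj]
    have hexp : ∀ k : ↥Λ, Real.exp (((a ⊓ b) k : Spin) * bd β K R Λ (cPlus d) k) =
        Real.exp ((a k : Spin) * bd β K R Λ (cPlus d) k) := by
      intro k
      by_cases hk : (k : Site d) ∈ Δ
      · have : bd β K R Λ (cPlus d) k = 0 := by
          unfold bd hsum
          rw [Finset.sum_eq_zero, mul_zero]
          intro j hj
          have : (k : Site d) + j ∈ Λ := ball_add hk hj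
          simp [this]
        rw [this, mul_zero, mul_zero]
      · rw [hab' k hk]
    have w_split : ∀ c : ↥Λ → Spin, wt β K R Λ (cPlus d) c =
        ((∏ k ∈ Dset K R L, Real.cosh (fld β K R k (patch Λ c (cPlus d)))) *
          ∏ k ∈ Λ \ Dset K R L, Real.cosh (fld β K R k (patch Λ c (cPlus d)))) *
          ∏ k : ↥Λ, Real.exp ((c k : Spin) * bd β K R Λ (cPlus d) k) := by
      intro c
      unfold wt
      rw [Finset.prod_mul_distrib, Finset.prod_coe_sort Λ
        (fun k => Real.cosh (fld β K R k (patch Λ c (cPlus d)))),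
        mul_comm (∏ k ∈ Dset K R L, _), Finset.prod_sdiff]
      exact Finset.filter_subset _ _
    have hrest : ∏ k ∈ Λ \ Dset K R L, Real.cosh (fld β K R k (patch Λ (a ⊓ b) (cPlus d))) =
        ∏ k ∈ Λ \ Dset K R L, Real.cosh (fld β K R k (patch Λ a (cPlus d))) := by
      refine Finset.prod_congr rfl fun k hk => ?_
      congr 1
      unfold fld hsum
      congr 1
      refine Finset.sum_congr rfl fun j hj => ?_
      by_cases hkj : k + j ∈ Δ
      · have hz : K (k - (k + j)) = 0 := by
          by_contra hne
          rw [Finset.mem_sdiff] at hk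
          apply hk.2
          simp only [Dset, Finset.mem_filter]
          exact ⟨hk.1, k + j, hkj, hne⟩
        have : K j = 0 := by
          rw [← hK.1, ← hz]; congr 1; abel
        rw [this, zero_mul, zero_mul]
      · congr 2
        beta_reduce
        by_cases hj' : k + j ∈ Λ
        · rw [patch_mem _ _ _ hj', patch_mem _ _ _ hj', hab' ⟨_, hj'⟩ hkj]
        · rw [patch_not_mem _ _ _ hj', patch_not_mem _ _ _ hj']
    rw [w_split, w_split, g1, g2, hrest, Finset.prod_congr rfl fun k _ => hexp k]
    have hmain : (∏ k ∈ Dset K R L, Real.cosh (fld β K R k (patch Λ a (cPlus d)))) *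
        (∏ k ∈ Dset K R L, Real.cosh (fld β K R k (patch Λ b (cPlus d)))) ≤
        (∏ k ∈ Dset K R L, Real.cosh (fld β K R k (patch Λ (a ⊓ b) (cPlus d)))) *
        (∏ k ∈ Dset K R L, Real.cosh (fld β K R k (patch Λ (a ⊔ b) (cPlus d)))) := by
      rw [← Finset.prod_mul_distrib, ← Finset.prod_mul_distrib]
      refine Finset.prod_le_prod (fun k _ => (mul_pos (Real.cosh_pos _) (Real.cosh_pos _)).le)
        fun k _ => ?_
      rw [hinf, hsup]
      exact cosh_fld hβ hKpos R k _ _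
    have hpos : 0 ≤ (∏ k ∈ Λ \ Dset K R L, Real.cosh (fld β K R k (patch Λ a (cPlus d)))) *
        ∏ k : ↥Λ, Real.exp ((a k : Spin) * bd β K R Λ (cPlus d) k) :=
      mul_nonneg (Finset.prod_nonneg fun k _ => (Real.cosh_pos _).le)
        (Finset.prod_nonneg fun k _ => (Real.exp_pos _).le)
    have := mul_le_mul_of_nonneg_right hmain hpos
    linarith

lemma nu_diff_le {K : Site d → ℝ} {R : ℕ} (hK : SymmFiniteRange K R) {β : ℝ} (hβ : 0 < β)
    (hKpos : ∀ k, 0 ≤ K k) (L : ℕ) :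
    nuE β K R (ball d (L + R)) (cPlus d) (fun σ => (σ ⟨0, zero_mem_ball d (L + R)⟩ : ℝ)) -
    nuE β K R (ball d (L + R)) (cMinus d) (fun σ => (σ ⟨0, zero_mem_ball d (L + R)⟩ : ℝ)) ≤
      atZero (zero_mem_ball d L) (gibbsFV β K (ball d L) (cPlus d)) -
      atZero (zero_mem_ball d L) (gibbsFV β K (ball d L) (cMinus d)) := by
  rw [nuE_flip, atZero_flip hK]
  have := nuE_le_gibbs hK hβ hKpos L
  linarith

end ClassC

namespace ClassC
variable {d : ℕ}

/-- discrepancy of the extremal dynamics at the origin -/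
noncomputable def rho (P : Kernel (Config d) (Config d)) (n : ℕ) : ℝ :=
  ∫ x, (x 0 : ℝ) ∂(iter P n (cPlus d)) - ∫ x, (x 0 : ℝ) ∂(iter P n (cMinus d))

lemma spin_mono (k : Site d) : Monotone (fun σ : Config d => (σ k : ℝ)) := fun _ _ h => h k

lemma dep_linear (Λ : Finset (Site d)) (c : Site d → ℝ) :
    DepOn Λ (fun σ => ∑ k ∈ Λ, c k * (σ k : ℝ)) := by
  intro σ η h
  exact Finset.sum_congr rfl fun k hk => by rw [h k hk]

lemma DepOn.superset {F F' : Finset (Site d)} {f : Config d → ℝ} (h : DepOn F f) (hs : F ⊆ F') :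
    DepOn F' f := fun σ η hση => h σ η fun k hk => hση k (hs hk)

section dyn
variable {β : ℝ} {K : Site d → ℝ} {R : ℕ} (hK : SymmFiniteRange K R)
    {P : Kernel (Config d) (Config d)} [IsMarkovKernel P]
    (hP : IsClassCKernel β K P) (hβ : 0 < β) (hKpos : ∀ k, 0 ≤ K k)

lemma comparison (hK : SymmFiniteRange K R) (hP : IsClassCKernel β K P) (hβ : 0 < β) (hKpos : ∀ k, 0 ≤ K k)
    (n : ℕ) {Λ : Finset (Site d)} {G : Config d → ℝ} (hG : DepOn Λ G)
    (c : Site d → ℝ) (hm : Monotone (fun σ : Config d => ∑ k ∈ Λ, c k * (σ k : ℝ) - G σ))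
    {a b : Config d} (hab : a ≤ b) :
    ∫ x, G x ∂(iter P n b) - ∫ x, G x ∂(iter P n a) ≤
      ∑ k ∈ Λ, c k * (∫ x, (x k : ℝ) ∂(iter P n b) - ∫ x, (x k : ℝ) ∂(iter P n a)) := by
  have hd : DepOn Λ (fun σ : Config d => ∑ k ∈ Λ, c k * (σ k : ℝ) - G σ) := by
    intro σ η h
    have := dep_linear Λ c σ η h
    simp only at this ⊢
    rw [hG σ η h, this]
  have h1 := iter_mono hK hP hβ hKpos n hd hm hab
  have h2 : ∀ η : Config d, ∫ x, (∑ k ∈ Λ, c k * (x k : ℝ) - G x) ∂(iter P n η) =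
      ∑ k ∈ Λ, c k * (∫ x, (x k : ℝ) ∂(iter P n η)) - ∫ x, G x ∂(iter P n η) := by
    intro η
    rw [integral_sub ((dep_linear Λ c).integrable _) (hG.integrable _), integral_finsetSum]
    · simp only [integral_const_mul]
    · intro k _
      exact ((dep_spin k).integrable _).const_mul _
  simp only [h2] at h1
  simp only [mul_sub, Finset.sum_sub_distrib]
  linarith

lemma spin_rho (hK : SymmFiniteRange K R) (hP : IsClassCKernel β K P)
    (k : Site d) (n : ℕ) :
    ∫ x, (x k : ℝ) ∂(iter P n (cPlus d)) - ∫ x, (x k : ℝ) ∂(iter P n (cMinus d)) = rho P n := by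
  rw [iter_spin hK hP k n _ (fun _ => rfl), iter_spin hK hP k n _ (fun _ => rfl), rho]

lemma rho_nonneg (hK : SymmFiniteRange K R) (hP : IsClassCKernel β K P) (hβ : 0 < β) (hKpos : ∀ k, 0 ≤ K k)
    (n : ℕ) : 0 ≤ rho P n :=
  sub_nonneg.2 (iter_mono hK hP hβ hKpos n (dep_spin 0) (spin_mono 0) (cMinus_le _))

lemma rho_anti (hK : SymmFiniteRange K R) (hP : IsClassCKernel β K P) (hβ : 0 < β) (hKpos : ∀ k, 0 ≤ K k)
    : Antitone (rho P) := by
  apply antitone_nat_of_succ_le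
  intro n
  have hm := iter_mono hK hP hβ hKpos n (dep_spin (0 : Site d)) (spin_mono 0)
  obtain ⟨F, hF⟩ := iter_dep hK hP n (dep_spin (0 : Site d))
  unfold rho
  rw [add_comm n 1, iter_add hK hP 1 n (dep_spin (0 : Site d)),
    iter_add hK hP 1 n (dep_spin (0 : Site d))]
  have h1 : ∫ η, (∫ x, (x 0 : ℝ) ∂(iter P n η)) ∂(iter P 1 (cPlus d)) ≤
      ∫ _, (∫ x, (x 0 : ℝ) ∂(iter P n (cPlus d))) ∂(iter P 1 (cPlus d)) :=
    integral_mono (hF.integrable _) (integrable_const _) fun η => hm (le_cPlus η)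
  have h2 : ∫ _, (∫ x, (x 0 : ℝ) ∂(iter P n (cMinus d))) ∂(iter P 1 (cMinus d)) ≤
      ∫ η, (∫ x, (x 0 : ℝ) ∂(iter P n η)) ∂(iter P 1 (cMinus d)) :=
    integral_mono (integrable_const _) (hF.integrable _) fun η => hm (cMinus_le η)
  simp only [integral_const, probReal_univ, one_smul] at h1 h2
  linarith

lemma nuE_sub (Λ : Finset (Site d)) (τ : Config d) (u v : (↥Λ → Spin) → ℝ) :
    nuE β K R Λ τ (fun σ => u σ - v σ) = nuE β K R Λ τ u - nuE β K R Λ τ v := by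
  simp only [nuE, mul_sub, Finset.sum_sub_distrib, sub_div]

lemma coe_mono_Λ {Λ : Finset (Site d)} (k : ↥Λ) : Monotone (fun σ : ↥Λ → Spin => (σ k : ℝ)) :=
  fun _ _ h => h k

/-- linear functions dominate functions with bounded oscillation -/
lemma lin_sub_mono (Λ : Finset (Site d)) {G : Config d → ℝ} (hG : DepOn Λ G)
    {r : ℝ} (hr : ∀ σ η, G η - G σ ≤ r) (h0 : 0 ≤ r) :
    Monotone (fun σ : Config d => ∑ k ∈ Λ, (r / 2) * (σ k : ℝ) - G σ) := by
  intro σ η h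
  simp only
  by_cases hall : ∀ k ∈ Λ, σ k = η k
  · have := dep_linear Λ (fun _ => r / 2) σ η hall
    simp only at this
    rw [hG σ η hall, this]
  · push Not at hall
    obtain ⟨k, hk, hne⟩ := hall
    have hs : r ≤ ∑ k ∈ Λ, ((r / 2) * (η k : ℝ) - (r / 2) * (σ k : ℝ)) := by
      have hk2 : r ≤ (r / 2) * (η k : ℝ) - (r / 2) * (σ k : ℝ) := by
        have := h k
        rcases spin_cases (σ k) with h1 | h1 <;> rcases spin_cases (η k) with h2 | h2
        · exact absurd (h1.trans h2.symm) hne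
        · rw [h1, h2] at this
          exact absurd (le_antisymm (le_sPlus _) this) sMinus_ne_sPlus
        · rw [h1, h2]; simp
        · exact absurd (h1.trans h2.symm) hne
      refine hk2.trans (Finset.single_le_sum
        (f := fun k => (r / 2) * (η k : ℝ) - (r / 2) * (σ k : ℝ)) (fun j _ => ?_) hk)
      have hj : (σ j : ℝ) ≤ η j := h j
      nlinarith
    rw [Finset.sum_sub_distrib] at hs
    linarith [hr σ η]

lemma recursion_aux (hK : SymmFiniteRange K R) (hP : IsClassCKernel β K P) (hβ : 0 < β) (hKpos : ∀ k, 0 ≤ K k)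
    (t : ℕ) (Λ : Finset (Site d)) (h0 : (0 : Site d) ∈ Λ) (σ : ↥Λ → Spin) :
    rho P (t + t) ≤ Λ.card * (rho P t) ^ 2 / 2 +
      (((Qop β K Λ (cPlus d))^[t + t] (fun σ => (σ ⟨0, h0⟩ : ℝ))) σ -
      ((Qop β K Λ (cMinus d))^[t + t] (fun σ => (σ ⟨0, h0⟩ : ℝ))) σ) := by
  set u : (↥Λ → Spin) → ℝ := fun σ => (σ ⟨0, h0⟩ : ℝ) with hu
  have hum : Monotone u := coe_mono_Λ _
  set g : Config d → ℝ := fun η => ∫ x, (x 0 : ℝ) ∂(iter P t η) with hg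
  obtain ⟨F, hF⟩ := iter_dep hK hP t (dep_spin (0 : Site d))
  have hgm : Monotone g := iter_mono hK hP hβ hKpos t (dep_spin (0 : Site d)) (spin_mono 0)
  have hosc : ∀ σ η, g η - g σ ≤ rho P t := fun σ η => by
    have h1 := hgm (le_cPlus η)
    have h2 := hgm (cMinus_le σ)
    simp only [hg, rho] at *
    linarith
  have hρ := rho_nonneg hK hP hβ hKpos t
  set gU : Config d → ℝ := fun η => g (patch Λ (res Λ η) (cPlus d)) with hgU
  set gL : Config d → ℝ := fun η => g (patch Λ (res Λ η) (cMinus d)) with hgL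
  have hUd : DepOn Λ gU := depOn_comp Λ (fun ζ => g (patch Λ ζ (cPlus d)))
  have hLd : DepOn Λ gL := depOn_comp Λ (fun ζ => g (patch Λ ζ (cMinus d)))
  have hpr : ∀ η : Config d, η ≤ patch Λ (res Λ η) (cPlus d) := by
    intro η j
    by_cases hj : j ∈ Λ
    · rw [patch_mem _ _ _ hj]; exact le_refl _
    · rw [patch_not_mem _ _ _ hj]; exact le_sPlus _
  have hpl : ∀ η : Config d, patch Λ (res Λ η) (cMinus d) ≤ η := by
    intro η j
    by_cases hj : j ∈ Λ
    · rw [patch_mem _ _ _ hj]; exact le_refl _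
    · rw [patch_not_mem _ _ _ hj]; exact sMinus_le _
  set η := patch Λ σ (cPlus d) with hη
  have hres : res Λ η = σ := res_patch _ _ _
  have c1 := comparison hK hP hβ hKpos t hUd (fun _ => rho P t / 2)
    (lin_sub_mono Λ hUd (fun a b => hosc _ _) hρ) (le_cPlus η)
  have c2 := comparison hK hP hβ hKpos t hLd (fun _ => rho P t / 2)
    (lin_sub_mono Λ hLd (fun a b => hosc _ _) hρ) (cMinus_le η)
  have csum : ∑ k ∈ Λ, rho P t / 2 * (∫ x, (x k : ℝ) ∂(iter P t (cPlus d)) -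
        ∫ x, (x k : ℝ) ∂(iter P t η)) + ∑ k ∈ Λ, rho P t / 2 * (∫ x, (x k : ℝ) ∂(iter P t η) -
        ∫ x, (x k : ℝ) ∂(iter P t (cMinus d))) = Λ.card * (rho P t) ^ 2 / 2 := by
    rw [← Finset.sum_add_distrib]
    rw [Finset.sum_congr rfl (g := fun _ => rho P t / 2 * rho P t)]
    · rw [Finset.sum_const, nsmul_eq_mul]; ring
    · intro k _
      rw [← mul_add, sub_add_sub_cancel, spin_rho hK hP]
  -- pointwise bounds
  have hUA : ∀ ξ, gU ξ ≤ ((Qop β K Λ (cPlus d))^[t] u) (res Λ ξ) := by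
    intro ξ
    have := iter_le_Q hK Λ hP hβ hKpos t hum (patch Λ (res Λ ξ) (cPlus d))
    rwa [res_patch] at this
  have hLB : ∀ ξ, ((Qop β K Λ (cMinus d))^[t] u) (res Λ ξ) ≤ gL ξ := by
    intro ξ
    have := Q_le_iter hK Λ hP hβ hKpos t hum (patch Λ (res Λ ξ) (cMinus d))
    rwa [res_patch] at this
  have e1 : ∫ x, gU x ∂(iter P t η) ≤ ((Qop β K Λ (cPlus d))^[t + t] u) σ := by
    rw [Function.iterate_add_apply, ← hres]
    refine le_trans (integral_mono (hUd.integrable _) ((depOn_comp Λ _).integrable _) hUA)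
      (iter_le_Q hK Λ hP hβ hKpos t (Qn_mono hK Λ _ hβ hKpos t hum) η)
  have e2 : ((Qop β K Λ (cMinus d))^[t + t] u) σ ≤ ∫ x, gL x ∂(iter P t η) := by
    rw [Function.iterate_add_apply, ← hres]
    refine le_trans (Q_le_iter hK Λ hP hβ hKpos t (Qn_mono hK Λ _ hβ hKpos t hum) η)
      (integral_mono ((depOn_comp Λ _).integrable _) (hLd.integrable _) hLB)
  have e3 : ∫ x, (x 0 : ℝ) ∂(iter P (t + t) (cPlus d)) ≤ ∫ x, gU x ∂(iter P t (cPlus d)) := by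
    rw [iter_add hK hP t t (dep_spin (0 : Site d))]
    exact integral_mono (hF.integrable _) (hUd.integrable _) fun ξ => hgm (hpr ξ)
  have e4 : ∫ x, gL x ∂(iter P t (cMinus d)) ≤ ∫ x, (x 0 : ℝ) ∂(iter P (t + t) (cMinus d)) := by
    rw [iter_add hK hP t t (dep_spin (0 : Site d))]
    exact integral_mono (hLd.integrable _) (hF.integrable _) fun ξ => hgm (hpl ξ)
  have : rho P (t + t) = ∫ x, (x 0 : ℝ) ∂(iter P (t + t) (cPlus d)) -
    ∫ x, (x 0 : ℝ) ∂(iter P (t + t) (cMinus d)) := rfl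
  linarith

lemma recursion (hK : SymmFiniteRange K R) (hP : IsClassCKernel β K P) (hβ : 0 < β) (hKpos : ∀ k, 0 ≤ K k)
    (t L : ℕ) : rho P (t + t) ≤ (ball d (L + R)).card * (rho P t) ^ 2 / 2 +
      (atZero (zero_mem_ball d L) (gibbsFV β K (ball d L) (cPlus d)) -
      atZero (zero_mem_ball d L) (gibbsFV β K (ball d L) (cMinus d))) := by
  set Λ := ball d (L + R) with hΛ
  have h0 : (0 : Site d) ∈ Λ := zero_mem_ball d (L + R)
  have h := fun σ => sub_le_iff_le_add'.2 (recursion_aux hK hP hβ hKpos t Λ h0 σ)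
  have h1 := nuE_mono (R := R) (β := β) (K := K) Λ (cPlus d) h
  rw [nuE_const, nuE_sub, nuE_Qn hK] at h1
  have hum : Monotone (fun σ : ↥Λ → Spin => (σ ⟨0, h0⟩ : ℝ)) := coe_mono_Λ _
  have h2 := nuE_pm hβ hKpos R Λ (Qn_mono hK Λ (cMinus d) hβ hKpos (t + t) hum)
  rw [nuE_Qn hK] at h2
  have h3 := nu_diff_le hK hβ hKpos L
  linarith

lemma rho_le_Q (hK : SymmFiniteRange K R) (hP : IsClassCKernel β K P) (hβ : 0 < β) (hKpos : ∀ k, 0 ≤ K k)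
    (L : ℕ) : ∃ r : ℝ, 0 ≤ r ∧ r < 1 ∧ ∀ n, rho P n ≤ 4 * r ^ n +
      (atZero (zero_mem_ball d L) (gibbsFV β K (ball d L) (cPlus d)) -
      atZero (zero_mem_ball d L) (gibbsFV β K (ball d L) (cMinus d))) := by
  set Λ := ball d (L + R) with hΛ
  have h0 : (0 : Site d) ∈ Λ := zero_mem_ball d (L + R)
  have hum : Monotone (fun σ : ↥Λ → Spin => (σ ⟨0, h0⟩ : ℝ)) := coe_mono_Λ _
  obtain ⟨r, hr0, hr1, hr⟩ := Q_contr hK Λ (cPlus d) hβ hKpos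
  obtain ⟨s, hs0, hs1, hs⟩ := Q_contr hK Λ (cMinus d) hβ hKpos
  refine ⟨max r s, le_max_of_le_left hr0, max_lt hr1 hs1, fun n => ?_⟩
  have h1 := hr _ hum n
  have h2 := hs _ hum n
  have h3 := Qn_le_nuE hK Λ (cPlus d) hβ hKpos n hum
  have h4 := nuE_le_Qn hK Λ (cMinus d) hβ hKpos n hum
  have h5 := iter_le_Q hK Λ hP hβ hKpos n hum (cPlus d)
  have h6 := Q_le_iter hK Λ hP hβ hKpos n hum (cMinus d)
  have h7 := nu_diff_le hK hβ hKpos L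
  have h8 : r ^ n ≤ max r s ^ n := pow_le_pow_left₀ hr0 (le_max_left _ _) n
  have h9 : s ^ n ≤ max r s ^ n := pow_le_pow_left₀ hs0 (le_max_right _ _) n
  simp only [coe_sPlus, coe_sMinus] at h1 h2
  have h10 : rho P n = ∫ x, (x 0 : ℝ) ∂(iter P n (cPlus d)) -
    ∫ x, (x 0 : ℝ) ∂(iter P n (cMinus d)) := rfl
  have e1 : res Λ (cPlus d) = fun _ => sPlus := rfl
  have e2 : res Λ (cMinus d) = fun _ => sMinus := rfl
  rw [e1] at h5
  rw [e2] at h6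
  simp only [res] at h5 h6
  linarith

end dyn
end ClassC

namespace ClassC
variable {d : ℕ}

lemma ball_card (d L : ℕ) : ((ball d L).card : ℝ) ≤ (2 * L + 1 : ℝ) ^ d := by
  have h : (ball d L).card ≤ (2 * L + 1) ^ d := by
    refine (Finset.card_filter_le _ _).trans ?_
    rw [Pi.card_Icc]
    simp only [Int.card_Icc, Finset.prod_const, Finset.card_univ, Fintype.card_fin]
    apply le_of_eq
    congr 1
    omega
  exact_mod_cast h

set_option maxHeartbeats 1000000 in
lemma numerics (ρ : ℕ → ℝ) (h0 : ∀ n, 0 ≤ ρ n) (hanti : Antitone ρ) (C M : ℝ) (hC : 0 < C)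
    (hM : 0 < M) (d R : ℕ)
    (hrec : ∀ t L : ℕ, 2 ≤ L → ρ (t + t) ≤ (2 * (L + R : ℕ) + 1 : ℝ) ^ d * (ρ t) ^ 2 / 2 +
      C * Real.exp (-M * L))
    (hsmall : ∀ ε > 0, ∃ n, ρ n ≤ ε) :
    ∃ lam > (0 : ℝ), ∃ n₁ : ℕ, 1 ≤ n₁ ∧ ∀ n, n₁ ≤ n → ρ n ≤ Real.exp (-lam * n) := by
  set D : ℝ := (2 * R + 3 : ℝ) ^ d with hD
  have hDpos : 1 ≤ D := one_le_pow₀ (by linarith [(Nat.cast_nonneg R : (0 : ℝ) ≤ R)])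
  set c : ℝ := 4 * C * D * 4 ^ d with hc
  have hcpos : 0 < c := by positivity
  have hev : ∀ᶠ z : ℝ in Filter.atTop, c * z ^ d ≤ Real.exp (M / 2 * z) := by
    have := (isLittleO_pow_exp_pos_mul_atTop d (half_pos hM)).bound (inv_pos.2 hcpos)
    filter_upwards [this, Filter.eventually_ge_atTop 0] with z hz hz0
    rw [Real.norm_of_nonneg (pow_nonneg hz0 _), Real.norm_of_nonneg (Real.exp_pos _).le] at hz
    rwa [inv_mul_eq_div, le_div_iff₀ hcpos, mul_comm] at hz
  obtain ⟨z0, hz0⟩ := Filter.eventually_atTop.1 hev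
  obtain ⟨N, hN⟩ := exists_nat_ge (max z0 (max 2 (4 / M)))
  have hNz : z0 ≤ N := (le_max_left _ _).trans hN
  have hN2 : (2 : ℝ) ≤ N := ((le_max_left _ _).trans (le_max_right _ _)).trans hN
  have hNM : 4 ≤ M * N := by
    have : 4 / M ≤ N := ((le_max_right _ _).trans (le_max_right _ _)).trans hN
    rw [div_le_iff₀ hM] at this; linarith
  set G : ℝ := 2 * D * N ^ d * 2 ^ d with hG
  have hG1 : 1 ≤ G := by
    have h1 : (1 : ℝ) ≤ (N : ℝ) ^ d := one_le_pow₀ (by linarith)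
    have h2 : (1 : ℝ) ≤ (2 : ℝ) ^ d := one_le_pow₀ (by norm_num)
    calc (1 : ℝ) ≤ D * N ^ d * 2 ^ d := one_le_mul_of_one_le_of_one_le
          (one_le_mul_of_one_le_of_one_le hDpos h1) h2
      _ ≤ G := by rw [hG]; nlinarith [mul_pos (mul_pos (lt_of_lt_of_le one_pos hDpos) (lt_of_lt_of_le one_pos h1)) (lt_of_lt_of_le one_pos h2)]
  have hGpos : 0 < G := by linarith
  obtain ⟨t1, ht1⟩ := hsmall (Real.exp (-1) / G) (by positivity)
  set t0 := t1 + 1 with ht0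
  have ht0' : ρ t0 ≤ Real.exp (-1) / G := (hanti (Nat.le_succ t1)).trans ht1
  have claim : ∀ k : ℕ, ρ (2 ^ k * t0) ≤ Real.exp (-2 ^ k) / (G * (2 ^ k) ^ d) := by
    intro k
    induction k with
    | zero => simpa using ht0'
    | succ k ih =>
      have hk1 : (1 : ℝ) ≤ 2 ^ k := one_le_pow₀ (by norm_num)
      set y : ℝ := 2 ^ k with hy
      set E := Real.exp (-y) with hE
      set W := y ^ d with hW
      have hWpos : 0 < W := by positivity
      have hEpos : 0 < E := Real.exp_pos _
      have hE2 : Real.exp (-2 ^ (k + 1)) = E ^ 2 := by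
        rw [hE, ← Real.exp_nat_mul]; congr 1; rw [pow_succ, ← hy]; push_cast; ring
      have hW2 : ((2 : ℝ) ^ (k + 1)) ^ d = W * 2 ^ d := by
        rw [pow_succ, mul_pow, ← hy]
      have hL2 : 2 ≤ N * 2 ^ k := by
        have : 2 ≤ N := by exact_mod_cast hN2
        calc 2 ≤ N := this
          _ ≤ N * 2 ^ k := Nat.le_mul_of_pos_right _ (by positivity)
      have hr := hrec (2 ^ k * t0) (N * 2 ^ k) hL2
      have e : 2 ^ k * t0 + 2 ^ k * t0 = 2 ^ (k + 1) * t0 := by ring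
      rw [e] at hr
      have hLc : ((N * 2 ^ k : ℕ) : ℝ) = N * y := by push_cast; rfl
      have hLp : (1 : ℝ) ≤ N * y := by nlinarith
      have hvol : (2 * ((N * 2 ^ k + R : ℕ) : ℝ) + 1) ^ d ≤ D * (N ^ d * W) := by
        rw [hD, hW, ← mul_pow, ← mul_pow]
        apply pow_le_pow_left₀ (by positivity)
        rw [Nat.cast_add, hLc]
        nlinarith [mul_nonneg (Nat.cast_nonneg R : (0 : ℝ) ≤ R) (sub_nonneg.2 hLp)]
      have hfirst : (2 * ((N * 2 ^ k + R : ℕ) : ℝ) + 1) ^ d * ρ (2 ^ k * t0) ^ 2 / 2 ≤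
          E ^ 2 / (G * (W * 2 ^ d)) / 2 := by
        have h1 : ρ (2 ^ k * t0) ^ 2 ≤ (E / (G * W)) ^ 2 := pow_le_pow_left₀ (h0 _) ih 2
        have h2 : (2 * ((N * 2 ^ k + R : ℕ) : ℝ) + 1) ^ d * ρ (2 ^ k * t0) ^ 2 ≤
            D * (N ^ d * W) * (E / (G * W)) ^ 2 :=
          mul_le_mul hvol h1 (by positivity) (by positivity)
        have h3 : D * (N ^ d * W) * (E / (G * W)) ^ 2 = E ^ 2 / (G * (W * 2 ^ d)) / 2 := by
          have hNd : (0 : ℝ) < (N : ℝ) ^ d := by positivity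
          rw [hG]
          field_simp
        have h4 : 0 ≤ D * (N ^ d * W) * (E / (G * W)) ^ 2 := by positivity
        linarith
      have hsecond : C * Real.exp (-M * (N * y)) ≤ E ^ 2 / (G * (W * 2 ^ d)) / 2 := by
        have hz := hz0 (N * y) (by nlinarith)
        have h1 : c * (N * y) ^ d = C * (2 * (G * (W * 2 ^ d))) := by
          rw [hc, hG, mul_pow, show (4 : ℝ) = 2 * 2 by norm_num, mul_pow]; ring
        have h2 : Real.exp (M / 2 * (N * y)) * Real.exp (-M * (N * y)) ≤ E ^ 2 := by
          rw [← hE2, ← Real.exp_add]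
          apply Real.exp_le_exp.2
          rw [pow_succ, ← hy]
          have h5 := mul_le_mul_of_nonneg_right hNM (zero_le_one.trans hk1)
          linarith
        rw [div_div, le_div_iff₀ (by positivity)]
        rw [h1] at hz
        have h3 := mul_le_mul_of_nonneg_right hz (Real.exp_pos (-M * (N * y))).le
        linarith
      rw [hE2, hW2]
      rw [hLc] at hr
      linarith
  refine ⟨1 / (2 * t0), by positivity, t0, by omega, fun n hn => ?_⟩
  have hq : n / t0 ≠ 0 := by
    rw [Nat.div_ne_zero_iff]; exact ⟨by omega, hn⟩
  set k := Nat.log 2 (n / t0) with hk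
  have hk1 : 2 ^ k * t0 ≤ n := by
    have := Nat.pow_log_le_self 2 hq
    exact (Nat.mul_le_mul_right _ this).trans (Nat.div_mul_le_self n t0)
  have hk2 : n < 2 ^ (k + 1) * t0 := by
    have := Nat.lt_pow_succ_log_self (b := 2) (by norm_num) (n / t0)
    rwa [Nat.div_lt_iff_lt_mul (by omega)] at this
  have hk2' : (n : ℝ) < 2 ^ (k + 1) * t0 := by exact_mod_cast hk2
  have ht0pos : (0 : ℝ) < t0 := by positivity
  calc ρ n ≤ ρ (2 ^ k * t0) := hanti hk1
    _ ≤ Real.exp (-2 ^ k) / (G * (2 ^ k) ^ d) := claim k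
    _ ≤ Real.exp (-2 ^ k) := div_le_self (Real.exp_pos _).le
        (one_le_mul_of_one_le_of_one_le hG1 (one_le_pow₀ (one_le_pow₀ (by norm_num))))
    _ ≤ Real.exp (-(1 / (2 * t0)) * n) := by
        apply Real.exp_le_exp.2
        rw [neg_mul, neg_le_neg_iff, one_div, inv_mul_eq_div, div_le_iff₀ (by positivity)]
        rw [pow_succ] at hk2'
        linarith

lemma varAt_bdd {F : Finset (Site d)} {f : Config d → ℝ} (h : DepOn F f) (k : Site d) :
    BddAbove {x : ℝ | ∃ σ η : Config d, (∀ j, j ≠ k → σ j = η j) ∧ x = |f σ - f η|} := by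
  obtain ⟨C, hC⟩ := h.bdd
  refine ⟨C + C, ?_⟩
  rintro x ⟨σ, η, -, rfl⟩
  exact (abs_sub _ _).trans (add_le_add (hC σ) (hC η))

lemma le_varAt {F : Finset (Site d)} {f : Config d → ℝ} (h : DepOn F f) (k : Site d)
    {σ η : Config d} (hση : ∀ j, j ≠ k → σ j = η j) : |f σ - f η| ≤ varAt k f :=
  le_csSup (varAt_bdd h k) ⟨σ, η, hση, rfl⟩

lemma varAt_nonneg {F : Finset (Site d)} {f : Config d → ℝ} (h : DepOn F f) (k : Site d) :
    0 ≤ varAt k f := (abs_nonneg _).trans (le_varAt h k (σ := cPlus d) (η := cPlus d) fun _ _ => rfl)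

lemma norm3_eq {F : Finset (Site d)} {f : Config d → ℝ} (h : DepOn F f) :
    norm3 f = ∑ k ∈ F, varAt k f := by
  apply finsum_eq_sum_of_support_subset
  intro k hk
  by_contra hkF
  apply hk
  apply le_antisymm _ (varAt_nonneg h k)
  refine csSup_le ⟨|f (cPlus d) - f (cPlus d)|, cPlus d, cPlus d, fun _ _ => rfl, rfl⟩ ?_
  rintro x ⟨σ, η, hs, rfl⟩
  rw [h σ η fun j hj => hs j fun e => hkF (by rw [← e]; exact hj)]
  simp

lemma telescoping {F : Finset (Site d)} {f : Config d → ℝ} (h : DepOn F f) {σ η : Config d}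
    (hση : σ ≤ η) : |f η - f σ| ≤ ∑ k ∈ F, varAt k f / 2 * ((η k : ℝ) - (σ k : ℝ)) := by
  classical
  have key : ∀ S : Finset (Site d), |f (fun j => if j ∈ S then η j else σ j) - f σ| ≤
      ∑ k ∈ S, varAt k f / 2 * ((η k : ℝ) - (σ k : ℝ)) := by
    intro S
    induction S using Finset.induction_on with
    | empty => simp
    | insert k S hk ih =>
      rw [Finset.sum_insert hk]
      have h1 : |f (fun j => if j ∈ insert k S then η j else σ j) -
          f (fun j => if j ∈ S then η j else σ j)| ≤ varAt k f / 2 * ((η k : ℝ) - (σ k : ℝ)) := by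
        by_cases he : σ k = η k
        · have : (fun j => if j ∈ insert k S then η j else σ j) =
              (fun j => if j ∈ S then η j else σ j) := by
            ext1 j
            by_cases hj : j = k
            · subst hj; simp [hk, he]
            · simp [hj]
          rw [this, he]; simp
        · have h2 : varAt k f / 2 * ((η k : ℝ) - (σ k : ℝ)) = varAt k f := by
            have := hση k
            rcases spin_cases (σ k) with h1 | h1 <;> rcases spin_cases (η k) with h2 | h2
            · exact absurd (h1.trans h2.symm) he
            · rw [h1, h2] at this
              exact absurd (le_antisymm (le_sPlus _) this) sMinus_ne_sPlus
            · rw [h1, h2, coe_sPlus, coe_sMinus]; ring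
            · exact absurd (h1.trans h2.symm) he
          rw [h2]
          apply le_varAt h
          intro j hj
          simp [hj]
      calc _ ≤ _ := abs_sub_le _ (f (fun j => if j ∈ S then η j else σ j)) _
        _ ≤ _ := add_le_add h1 ih
  have := key F
  rwa [h (fun j => if j ∈ F then η j else σ j) η (fun k hk => by simp [hk])] at this

section dyn
variable {β : ℝ} {K : Site d → ℝ} {R : ℕ} (hK : SymmFiniteRange K R)
    {P : Kernel (Config d) (Config d)} [IsMarkovKernel P]
    (hP : IsClassCKernel β K P) (hβ : 0 < β) (hKpos : ∀ k, 0 ≤ K k)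

lemma local_half (hK : SymmFiniteRange K R) (hP : IsClassCKernel β K P) (hβ : 0 < β) (hKpos : ∀ k, 0 ≤ K k)
    {F : Finset (Site d)} {f : Config d → ℝ} (h : DepOn F f) (n : ℕ) (σ : Config d) :
    |∫ x, f x ∂(iter P n (cPlus d)) - ∫ x, f x ∂(iter P n σ)| ≤ norm3 f * rho P n / 2 := by
  have hneg : DepOn F (fun σ => - f σ) := fun a b hab => by simp only [h a b hab]
  have c1 := comparison hK hP hβ hKpos n h (fun k => varAt k f / 2) (by
    intro a b hab
    have := abs_le.1 (telescoping h hab)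
    simp only [mul_sub, Finset.sum_sub_distrib] at this ⊢
    linarith) (le_cPlus σ)
  have c2 := comparison hK hP hβ hKpos n hneg (fun k => varAt k f / 2) (by
    intro a b hab
    have := abs_le.1 (telescoping h hab)
    simp only [mul_sub, Finset.sum_sub_distrib] at this ⊢
    linarith) (le_cPlus σ)
  have c3 : ∑ k ∈ F, varAt k f / 2 * (∫ x, (x k : ℝ) ∂(iter P n (cPlus d)) -
      ∫ x, (x k : ℝ) ∂(iter P n σ)) ≤ norm3 f * rho P n / 2 := by
    rw [norm3_eq h, Finset.sum_mul, Finset.sum_div]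
    refine Finset.sum_le_sum fun k _ => ?_
    rw [← spin_rho hK hP k n, mul_div_right_comm]
    apply mul_le_mul_of_nonneg_left _ (by linarith [varAt_nonneg h k])
    have := iter_mono hK hP hβ hKpos n (dep_spin k) (spin_mono k) (cMinus_le σ)
    simp only at this
    linarith
  simp only [integral_neg] at c2
  rw [abs_le]
  constructor <;> linarith

lemma local_bound (hK : SymmFiniteRange K R) (hP : IsClassCKernel β K P) (hβ : 0 < β) (hKpos : ∀ k, 0 ≤ K k)
    {F : Finset (Site d)} {f : Config d → ℝ} (h : DepOn F f) (n : ℕ)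
    (σ η : Config d) :
    |∫ x, f x ∂(iter P n σ) - ∫ x, f x ∂(iter P n η)| ≤ norm3 f * rho P n := by
  have h1 := abs_le.1 (local_half hK hP hβ hKpos h n σ)
  have h2 := abs_le.1 (local_half hK hP hβ hKpos h n η)
  rw [abs_le]
  constructor <;> linarith

lemma local_bound_meas (hK : SymmFiniteRange K R) (hP : IsClassCKernel β K P) (hβ : 0 < β) (hKpos : ∀ k, 0 ≤ K k)
    {F : Finset (Site d)} {f : Config d → ℝ} (h : DepOn F f) (n : ℕ)
    (σ : Config d) (μ : Measure (Config d)) [IsProbabilityMeasure μ] :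
    |∫ x, f x ∂(iter P n σ) - ∫ η, (∫ x, f x ∂(iter P n η)) ∂μ| ≤ norm3 f * rho P n := by
  obtain ⟨F', hF'⟩ := iter_dep hK hP n h
  have hb := fun η => abs_le.1 (local_bound hK hP hβ hKpos h n σ η)
  have h1 : ∫ η, (∫ x, f x ∂(iter P n η)) ∂μ ≤
      ∫ _, (∫ x, f x ∂(iter P n σ) + norm3 f * rho P n) ∂μ :=
    integral_mono (hF'.integrable _) (integrable_const _) fun η => by
      have := hb η; simp only; linarith
  have h2 : ∫ _, (∫ x, f x ∂(iter P n σ) - norm3 f * rho P n) ∂μ ≤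
      ∫ η, (∫ x, f x ∂(iter P n η)) ∂μ :=
    integral_mono (integrable_const _) (hF'.integrable _) fun η => by
      have := hb η; simp only; linarith
  simp only [integral_const, probReal_univ, one_smul] at h1 h2
  rw [abs_le]
  constructor <;> linarith

lemma exists_limit (hK : SymmFiniteRange K R) (hP : IsClassCKernel β K P) (hβ : 0 < β) (hKpos : ∀ k, 0 ≤ K k)
    : ∃ ν : Measure (Config d), IsProbabilityMeasure ν ∧
    ∀ {F : Finset (Site d)} {f : Config d → ℝ} (_ : DepOn F f) (n : ℕ) (σ : Config d),
      |∫ x, f x ∂(iter P n σ) - ∫ x, f x ∂ν| ≤ norm3 f * rho P n := by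
  let s : ℕ → ProbabilityMeasure (Config d) := fun m => ⟨iter P m (cPlus d), inferInstance⟩
  obtain ⟨ν, -, hν⟩ := isCompact_univ.ultrafilter_le_nhds'
    ((Filter.hyperfilter ℕ).map s) Filter.univ_mem
  have hν' : Filter.Tendsto s (Filter.hyperfilter ℕ) (nhds ν) := hν
  refine ⟨ν, inferInstance, fun {F f} h n σ => ?_⟩
  rw [ProbabilityMeasure.tendsto_iff_forall_integral_tendsto] at hν'
  obtain ⟨C, hC⟩ := h.bdd
  have ht := hν' (BoundedContinuousFunction.ofNormedAddCommGroup f h.continuous C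
    (fun x => by simpa using hC x))
  simp only [BoundedContinuousFunction.coe_ofNormedAddCommGroup] at ht
  have ht2 := (tendsto_const_nhds (x := ∫ x, f x ∂(iter P n σ))).sub ht |>.abs
  refine le_of_tendsto ht2 ?_
  have hev : ∀ᶠ m : ℕ in (Filter.hyperfilter ℕ : Filter ℕ), n ≤ m :=
    Nat.hyperfilter_le_atTop (Filter.eventually_ge_atTop n)
  filter_upwards [hev] with m hm
  obtain ⟨j, rfl⟩ := Nat.exists_eq_add_of_le' hm
  change |_ - ∫ x, f x ∂(iter P (j + n) (cPlus d))| ≤ _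
  rw [iter_add hK hP j n h]
  exact local_bound_meas hK hP hβ hKpos h n σ _

end dyn
end ClassC

open ClassC in
/-- Theorem 2, quantitative part: weak mixing implies exponentially
fast ergodicity for class-C PCA: under the finite-volume form of the weak mixing
condition for the potential `φ`, the class-C dynamics admits a unique stationary
probability measure `ν` and converges to it exponentially fast, uniformly over the
initial configuration, for every local function. -/
theorem stmt_16
    (d : ℕ) (hd : 1 ≤ d) (β : ℝ) (hβ : 0 < β)
    (K : Site d → ℝ) (R : ℕ) (hR : 1 ≤ R) (hK : SymmFiniteRange K R)
    (hKpos : ∀ k, 0 ≤ K k)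
    (P : Kernel (Config d) (Config d)) (hMarkov : IsMarkovKernel P)
    (hP : IsClassCKernel β K P)
    (C M : ℝ) (hC : 0 < C) (hM : 0 < M)
    (hWM : ∀ L : ℕ, 2 ≤ L →
      atZero (zero_mem_ball d L) (gibbsFV β K (ball d L) (cPlus d)) -
          atZero (zero_mem_ball d L) (gibbsFV β K (ball d L) (cMinus d)) ≤
        C * Real.exp (-M * L)) :
    ∃ ν : Measure (Config d), IsProbabilityMeasure ν ∧
      ν.bind (fun η => P η) = ν ∧
      (∀ ν' : Measure (Config d), IsProbabilityMeasure ν' →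
        ν'.bind (fun η => P η) = ν' → ν' = ν) ∧
      ∃ lam > (0 : ℝ), ∃ n₁ : ℕ, 1 ≤ n₁ ∧
        ∀ n : ℕ, n₁ ≤ n → ∀ f : Config d → ℝ, IsLocalFn f →
          ∀ σ : Config d,
            |∫ x, f x ∂(iter P n σ) - ∫ x, f x ∂ν| ≤ 2 * norm3 f * Real.exp (-lam * n) := by
  have hsmall : ∀ ε > 0, ∃ n, rho P n ≤ ε := by
    intro ε hε
    have hl : Filter.Tendsto (fun L : ℕ => C * Real.exp (-M * L)) Filter.atTop (nhds 0) := by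
      have h1 : Filter.Tendsto (fun L : ℕ => M * (L : ℝ)) Filter.atTop Filter.atTop :=
        tendsto_natCast_atTop_atTop.const_mul_atTop hM
      have h2 := (Real.tendsto_exp_neg_atTop_nhds_zero.comp h1).const_mul C
      simpa [Function.comp_def] using h2
    obtain ⟨L, hL, hL2⟩ := ((hl.eventually_lt_const (half_pos hε)).and
      (Filter.eventually_ge_atTop 2)).exists
    obtain ⟨r, hr0, hr1, hr⟩ := rho_le_Q hK hP hβ hKpos L
    have hp := (tendsto_pow_atTop_nhds_zero_of_lt_one hr0 hr1).const_mul 4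
    rw [mul_zero] at hp
    obtain ⟨n, hn⟩ := (hp.eventually_lt_const (half_pos hε)).exists
    exact ⟨n, by linarith [hr n, hWM L hL2]⟩
  obtain ⟨lam, hlam, n₁, hn₁, hexp⟩ := numerics (rho P) (rho_nonneg hK hP hβ hKpos)
    (rho_anti hK hP hβ hKpos) C M hC hM d R (by
      intro t L hL
      have h1 := recursion hK hP hβ hKpos t L
      have h2 := mul_le_mul_of_nonneg_right (ball_card d (L + R)) (sq_nonneg (rho P t))
      linarith [hWM L hL]) hsmall
  obtain ⟨ν, hν, hlim⟩ := exists_limit hK hP hβ hKpos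
  have hρ0 : Filter.Tendsto (rho P) Filter.atTop (nhds 0) := by
    rw [Metric.tendsto_atTop]
    intro ε hε
    obtain ⟨n, hn⟩ := hsmall (ε / 2) (half_pos hε)
    refine ⟨n, fun m hm => ?_⟩
    rw [Real.dist_eq, sub_zero, abs_of_nonneg (rho_nonneg hK hP hβ hKpos m)]
    linarith [rho_anti hK hP hβ hKpos hm]
  have htend : ∀ {F : Finset (Site d)} {f : Config d → ℝ} (_ : DepOn F f) (σ : Config d),
      Filter.Tendsto (fun n => ∫ x, f x ∂(iter P n σ)) Filter.atTop (nhds (∫ x, f x ∂ν)) := by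
    intro F f h σ
    rw [tendsto_iff_dist_tendsto_zero]
    refine squeeze_zero (fun _ => dist_nonneg) (fun n => ?_)
      (by simpa using hρ0.const_mul (norm3 f))
    rw [Real.dist_eq]
    exact hlim h n σ
  have hbindp : ∀ μ : Measure (Config d), IsProbabilityMeasure μ →
      IsProbabilityMeasure (μ.bind fun η => P η) := fun μ hμ => by
    change IsProbabilityMeasure (μ.bind P); infer_instance
  refine ⟨ν, hν, ?_, ?_, lam, hlam, n₁, hn₁, ?_⟩
  · have := hbindp ν hν
    apply meas_ext
    intro F u
    have h := depOn_comp F u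
    rw [integral_bind' h]
    have h1 := htend (step_dep hK hP h) (cPlus d)
    have h2 := (Filter.tendsto_add_atTop_iff_nat 1).2 (htend h (cPlus d))
    refine tendsto_nhds_unique h1 (h2.congr fun n => ?_)
    exact iter_succ h n _
  · intro ν' hν' hstat
    apply meas_ext
    intro F u
    have h := depOn_comp F u
    have hb : ∀ n, |∫ x, u (res F x) ∂(iter P n (cPlus d)) - ∫ x, u (res F x) ∂ν'| ≤
        norm3 (fun x => u (res F x)) * rho P n := by
      intro n
      have := local_bound_meas hK hP hβ hKpos h n (cPlus d) ν'
      rwa [stat_iter hK hP hstat n h] at this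
    refine tendsto_nhds_unique ?_ (htend h (cPlus d))
    rw [tendsto_iff_dist_tendsto_zero]
    refine squeeze_zero (fun _ => dist_nonneg) (fun n => ?_)
      (by simpa using hρ0.const_mul (norm3 (fun x => u (res F x))))
    rw [Real.dist_eq]
    exact hb n
  · rintro n hn f ⟨F, h⟩ σ
    have h' : DepOn F f := h
    have hn0 : 0 ≤ norm3 f := by
      rw [norm3_eq h']; exact Finset.sum_nonneg fun k _ => varAt_nonneg h' k
    have h1 := hlim h' n σ
    have h2 := mul_le_mul_of_nonneg_left (hexp n hn) hn0
    have h3 := mul_nonneg hn0 (Real.exp_pos (-lam * n)).le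
    linarith
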